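/- arXiv:math/0201002 — 2 statements merged into one kernel-verified Lean document; each statement's English description precedes it below -/
import Mathlib

section
/- Theorem A: Let G be a word-hyperbolic group and let H be a finitely generated subgroup of G. Then the Frattini subgroup F(H) of H is finite. -/
/-- The word length of `g` with respect to a generating set `S`:
the least `n` such that `g` is a product of `n` elements of `S ∪ S⁻¹`. -/
noncomputable def wordLength {G : Type*} [Group G] (S : Set G) (g : G) : ℕ :=
  sInf {n : ℕ | ∃ l : List G, l.length = n ∧ (∀ x ∈ l, x ∈ S ∨ x⁻¹ ∈ S) ∧ l.prod = g}

/-- The word metric on `G` with respect to a generating set `S`. -/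
noncomputable def wordDist {G : Type*} [Group G] (S : Set G) (g h : G) : ℕ :=
  wordLength S (g⁻¹ * h)

/-- The word metric on `G` w.r.t. `S` satisfies the Gromov
four-point condition with constant `δ`. -/
def GromovFourPoint {G : Type*} [Group G] (S : Set G) (δ : ℝ) : Prop :=
  ∀ x y z w : G,
    (wordDist S x y : ℝ) + (wordDist S z w : ℝ) ≤
      max ((wordDist S x z : ℝ) + (wordDist S y w : ℝ))
          ((wordDist S x w : ℝ) + (wordDist S y z : ℝ)) + 2 * δ

/-- A group is word-hyperbolic if it has a finite generating set whose
word metric satisfies the Gromov four-point condition for some `δ ≥ 0`. -/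
def IsWordHyperbolic (G : Type*) [Group G] : Prop :=
  ∃ S : Finset G, Subgroup.closure (S : Set G) = ⊤ ∧
    ∃ δ : ℝ, 0 ≤ δ ∧ GromovFourPoint (S : Set G) δ

structure HypMetric (G : Type*) [Group G] where
  d : G → G → ℤ
  D : ℤ
  D_nonneg : 0 ≤ D
  nonneg : ∀ x y, 0 ≤ d x y
  self : ∀ x, d x x = 0
  symm : ∀ x y, d x y = d y x
  tri : ∀ x y z, d x z ≤ d x y + d y z
  inv : ∀ g x y, d (g * x) (g * y) = d x y
  geo : ∀ (y : G) (T : ℤ), 0 ≤ T → T ≤ d 1 y → ∃ p, d 1 p = T ∧ d p y = d 1 y - T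
  fin : ∀ n : ℤ, {g | d 1 g ≤ n}.Finite
  four : ∀ x y z w, d x y + d z w ≤ d x z + d y w + D ∨ d x y + d z w ≤ d x w + d y z + D

theorem wl_le {G : Type*} [Group G] (S : Set G) (l : List G)
    (hl : ∀ x ∈ l, x ∈ S ∨ x⁻¹ ∈ S) : wordLength S l.prod ≤ l.length :=
  Nat.sInf_le ⟨l, rfl, hl, rfl⟩

theorem wl_exists {G : Type*} [Group G] (S : Set G) (hS : Subgroup.closure S = ⊤) (g : G) :
    ∃ l : List G, l.length = wordLength S g ∧ (∀ x ∈ l, x ∈ S ∨ x⁻¹ ∈ S) ∧ l.prod = g := by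
  have hne : {n : ℕ | ∃ l : List G, l.length = n ∧ (∀ x ∈ l, x ∈ S ∨ x⁻¹ ∈ S) ∧
      l.prod = g}.Nonempty := by
    have hg : g ∈ Subgroup.closure S := by rw [hS]; trivial
    rw [← Subgroup.mem_toSubmonoid, Subgroup.closure_toSubmonoid] at hg
    obtain ⟨l, h1, h2⟩ := Submonoid.exists_list_of_mem_closure hg
    exact ⟨l.length, l, rfl, fun x hx => by simpa using h1 x hx, h2⟩
  exact Nat.sInf_mem hne

theorem wl_mul {G : Type*} [Group G] (S : Set G) (hS : Subgroup.closure S = ⊤) (g h : G) :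
    wordLength S (g * h) ≤ wordLength S g + wordLength S h := by
  obtain ⟨l, h1, h2, h3⟩ := wl_exists S hS g
  obtain ⟨l', h1', h2', h3'⟩ := wl_exists S hS h
  have := wl_le S (l ++ l') (by
    intro x hx
    rcases List.mem_append.1 hx with hx | hx
    · exact h2 x hx
    · exact h2' x hx)
  rw [List.prod_append, List.length_append, h3, h3'] at this
  omega

theorem wl_inv_le {G : Type*} [Group G] (S : Set G) (hS : Subgroup.closure S = ⊤) (g : G) :
    wordLength S g⁻¹ ≤ wordLength S g := by
  obtain ⟨l, h1, h2, h3⟩ := wl_exists S hS g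
  have := wl_le S (l.map (·⁻¹)).reverse (by
    intro x hx
    simp only [List.mem_reverse, List.mem_map] at hx
    obtain ⟨a, ha, rfl⟩ := hx
    rw [inv_inv]
    exact (h2 a ha).symm)
  rw [← List.prod_inv_reverse, h3] at this
  simpa [h1] using this

theorem wl_fin {G : Type*} [Group G] (S : Set G) (hf : S.Finite) (n : ℕ) :
    {g : G | ∃ l : List G, l.length = n ∧ (∀ x ∈ l, x ∈ S ∨ x⁻¹ ∈ S) ∧ l.prod = g}.Finite := by
  induction n with
  | zero =>
    apply (Set.finite_singleton (1 : G)).subset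
    rintro g ⟨l, h1, -, h3⟩
    rw [List.length_eq_zero_iff] at h1
    subst h1
    simpa using h3.symm
  | succ n ih =>
    have hA : (S ∪ S⁻¹).Finite := hf.union hf.inv
    apply (Set.Finite.image2 (fun a b => a * b) hA ih).subset
    rintro g ⟨l, h1, h2, h3⟩
    cases l with
    | nil => simp at h1
    | cons a l =>
      refine ⟨a, ?_, l.prod, ⟨l, by simpa using h1, fun x hx => h2 x (by simp [hx]), rfl⟩, ?_⟩
      · simpa using h2 a (by simp)
      · simpa using h3

theorem exists_hypMetric {G : Type*} [Group G] (hG : IsWordHyperbolic G) :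
    Nonempty (HypMetric G) := by
  obtain ⟨S, hS, δ, hδ, h4⟩ := hG
  have one : wordLength (S : Set G) 1 = 0 := by
    have := wl_le (S : Set G) [] (by simp)
    simpa using this
  have tri : ∀ x y z, wordDist (S : Set G) x z ≤ wordDist (S : Set G) x y + wordDist (S : Set G) y z := by
    intro x y z
    have := wl_mul (S : Set G) hS (x⁻¹ * y) (y⁻¹ * z)
    unfold wordDist
    simpa [mul_assoc] using this
  have symm : ∀ x y, wordDist (S : Set G) x y ≤ wordDist (S : Set G) y x := by
    intro x y
    have := wl_inv_le (S : Set G) hS (y⁻¹ * x)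
    unfold wordDist
    simpa [mul_assoc] using this
  refine ⟨⟨fun x y => (wordDist (S : Set G) x y : ℤ), ⌈2 * δ⌉, ?_, ?_, ?_, ?_, ?_, ?_, ?_, ?_, ?_⟩⟩
  · positivity
  · intro x y; positivity
  · intro x; simp [wordDist, one]
  · intro x y
    have := symm x y
    have := symm y x
    omega
  · intro x y z
    exact_mod_cast tri x y z
  · intro g x y
    simp [wordDist, mul_assoc]
  · intro y T hT hTy
    lift T to ℕ using hT
    obtain ⟨l, h1, h2, h3⟩ := wl_exists (S : Set G) hS y
    have e1 : wordDist (S : Set G) 1 y = wordLength (S : Set G) y := by simp [wordDist]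
    have a1 := wl_le (S : Set G) (l.take T) (fun x hx => h2 x (List.mem_of_mem_take hx))
    have a2 := wl_le (S : Set G) (l.drop T) (fun x hx => h2 x (List.mem_of_mem_drop hx))
    have a3 := wl_mul (S : Set G) hS (l.take T).prod (l.drop T).prod
    rw [List.prod_take_mul_prod_drop, h3] at a3
    have e2 : wordDist (S : Set G) (l.take T).prod y = wordLength (S : Set G) (l.drop T).prod := by
      unfold wordDist
      congr 1
      rw [inv_mul_eq_iff_eq_mul, List.prod_take_mul_prod_drop, h3]
    have e3 : wordDist (S : Set G) 1 (l.take T).prod = wordLength (S : Set G) (l.take T).prod := by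
      simp [wordDist]
    simp only [List.length_take, List.length_drop] at a1 a2
    refine ⟨(l.take T).prod, ?_, ?_⟩ <;> simp only [e1, e2, e3] at * <;> omega
  · intro n
    have : (⋃ k ∈ Set.Iic n.toNat, {g : G | ∃ l : List G, l.length = k ∧
        (∀ x ∈ l, x ∈ (S : Set G) ∨ x⁻¹ ∈ (S : Set G)) ∧ l.prod = g}).Finite :=
      Set.Finite.biUnion (Set.finite_Iic _) (fun k _ => wl_fin _ S.finite_toSet k)
    apply this.subset
    intro g hg
    simp only [Set.mem_ofPred_eq, wordDist, inv_one, one_mul] at hg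
    simp only [Set.mem_iUnion]
    exact ⟨wordLength (S : Set G) g, by simp only [Set.mem_Iic]; omega, wl_exists _ hS g⟩
  · intro x y z w
    have h := h4 x y z w
    have hc := Int.le_ceil (2 * δ)
    rcases le_total ((wordDist (S : Set G) x z : ℝ) + (wordDist (S : Set G) y w : ℝ))
      ((wordDist (S : Set G) x w : ℝ) + (wordDist (S : Set G) y z : ℝ)) with h' | h'
    · right
      rw [max_eq_right h'] at h
      have h2 := h.trans (add_le_add_right hc _)
      exact_mod_cast h2
    · left
      rw [max_eq_left h'] at h
      have h2 := h.trans (add_le_add_right hc _)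
      exact_mod_cast h2

namespace HypMetric

variable {G : Type*} [Group G] (m : HypMetric G)

/-- twice the Gromov product of `x` and `y` at `b` -/
def gp (b x y : G) : ℤ := m.d b x + m.d b y - m.d x y

theorem gp_four (b x y z : G) :
    m.gp b x y ≤ m.gp b x z + m.D ∨ m.gp b y z ≤ m.gp b x z + m.D := by
  have h := m.four x z b y
  have h1 := m.symm x b
  have h2 := m.symm z b
  have h3 := m.symm z y
  have h4 := m.symm x y
  unfold gp
  omega

theorem inv_one_left (g x : G) : m.d 1 (g⁻¹ * x) = m.d g x := by
  have := m.inv g 1 (g⁻¹ * x)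
  rw [← this]; simp

theorem d_inv (g : G) : m.d 1 g⁻¹ = m.d 1 g := by
  have := m.inv_one_left g 1
  rw [mul_one] at this
  rw [this, m.symm]

theorem d_mul_right (x g : G) : m.d x (x * g) = m.d 1 g := by
  have := m.inv x 1 g
  rwa [mul_one] at this

theorem gp_comm (b x y : G) : m.gp b x y = m.gp b y x := by
  unfold gp
  have := m.symm x y
  omega

/-- infinite order criterion -/
theorem inf_order (p t : G) (h : m.d p (t * p) + m.D < m.d p (t * (t * p))) :
    ¬ IsOfFinOrder t := by
  have key : ∀ n : ℕ, m.d p (t ^ n * p) < m.d p (t ^ (n + 1) * p) := by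
    intro n
    induction n with
    | zero =>
      have h1 := m.tri p (t * p) (t * (t * p))
      rw [m.inv] at h1
      have := m.D_nonneg
      simp only [pow_zero, one_mul, zero_add, pow_one, m.self]
      omega
    | succ n ih =>
      have h4 := m.four p (t * (t * p)) (t * p) (t ^ (n + 2) * p)
      have e1 : m.d (t * p) (t ^ (n + 2) * p) = m.d p (t ^ (n + 1) * p) := by
        rw [pow_succ' t (n + 1), mul_assoc, m.inv]
      have e2 : m.d (t * (t * p)) (t ^ (n + 2) * p) = m.d p (t ^ n * p) := by
        rw [pow_succ' t (n + 1), pow_succ' t n, mul_assoc, mul_assoc, m.inv, m.inv]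
      have e3 : m.d (t * (t * p)) (t * p) = m.d p (t * p) := by
        rw [m.inv, m.symm]
      rw [e1, e2, e3] at h4
      show m.d p (t ^ (n + 1) * p) < m.d p (t ^ (n + 2) * p)
      omega
  have mono : StrictMono (fun n : ℕ => m.d p (t ^ n * p)) := strictMono_nat_of_lt_succ key
  rw [isOfFinOrder_iff_pow_eq_one]
  rintro ⟨n, hn, h1⟩
  have := mono hn
  simp [h1] at this

theorem config (R C : ℤ) (hC : C = 10 * R + 10 * m.D + 10) (y p t : G)
    (hp1 : m.d 1 p = R + m.D + 1) (hp2 : m.d p y = m.d 1 y - (R + m.D + 1))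
    (ht : m.d 1 t ≤ R) (hg : C ≤ m.gp 1 (t * y) y) : m.gp (t * p) 1 y ≤ 2 * m.D := by
  have hD := m.D_nonneg
  -- four-point twice at `t * p`
  have h1 := m.gp_four (t * p) t 1 (t * y)
  have h2 := m.gp_four (t * p) 1 y (t * y)
  have e1 : m.d (t * p) t = R + m.D + 1 := by
    rw [m.symm, m.d_mul_right, hp1]
  have e2 : m.d (t * p) (t * y) = m.d 1 y - (R + m.D + 1) := by rw [m.inv, hp2]
  have e3 : m.d t (t * y) = m.d 1 y := m.d_mul_right _ _
  have t1 := m.tri 1 (t * p) t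
  have t2 := m.tri 1 (t * p) (t * y)
  have t3 := m.tri 1 (t * p) y
  have t4 := m.tri 1 t (t * p)
  have t5 := m.d_mul_right t p
  have t6 := m.tri (t * p) 1 t
  have s1 := m.symm 1 t
  have s2 := m.symm 1 (t * p)
  have s3 := m.symm y (t * y)
  have t7 := m.tri t 1 (t * p)
  unfold gp at *
  omega

theorem config_dist (y u v : G) (hu : m.gp u 1 y ≤ 2 * m.D) (hv : m.gp v 1 y ≤ 2 * m.D) :
    m.d u v ≤ |m.d u y - m.d v y| + 3 * m.D := by
  have h := m.four u v 1 y
  unfold gp at *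
  have := le_abs_self (m.d u y - m.d v y)
  have := neg_abs_le (m.d u y - m.d v y)
  omega

theorem config_fin (R C : ℤ) (hC : C = 10 * R + 10 * m.D + 10) (y p t : G)
    (hp1 : m.d 1 p = R + m.D + 1) (hp2 : m.d p y = m.d 1 y - (R + m.D + 1))
    (ht : m.d 1 t ≤ R) (hg : C ≤ m.gp 1 (t * y) y) (hfin : IsOfFinOrder t) :
    m.d p (t * p) ≤ 8 * m.D := by
  have hD := m.D_nonneg
  have hR : 0 ≤ R := le_trans (m.nonneg _ _) ht
  by_contra hcon
  refine m.inf_order p t ?_ hfin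
  have c1 := m.config R C hC y p t hp1 hp2 ht hg
  have c0 : m.gp p 1 y ≤ 2 * m.D := by
    have := m.symm 1 p
    unfold gp; omega
  have c2 := m.config_dist y p (t * p) c0 c1
  -- inverse
  have f1 := m.four p y (t * p) (t * y)
  have f2 := m.four p (t * y) (t * p) y
  have e1 : m.d (t * p) (t * y) = m.d p y := m.inv _ _ _
  have e2 : m.d p (t * (t * p)) = m.d (t⁻¹ * p) (t * p) := by
    rw [← m.inv t (t⁻¹ * p)]; simp
  have e3 : m.d (t⁻¹ * p) y = m.d p (t * y) := by
    rw [← m.inv t (t⁻¹ * p)]; simp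
  have t1 := m.tri (t⁻¹ * p) (t * p) y
  have t2 := m.tri (t * p) (t⁻¹ * p) y
  have s1 := m.symm (t * p) (t⁻¹ * p)
  have t3 := m.tri 1 t (t * y)
  have t4 := m.d_mul_right t y
  have t5 := m.tri p 1 (t * p)
  have t6 := m.tri 1 t (t * p)
  have t7 := m.d_mul_right t p
  have s2 := m.symm 1 p
  have s3 := m.symm y (t * y)
  have s4 := m.symm y (t * p)
  have s5 := m.symm (t * y) (t * p)
  unfold gp at hg
  rcases abs_cases (m.d p y - m.d (t * p) y) with ⟨h, _⟩ | ⟨h, _⟩ <;> rw [h] at c2 <;> omega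

/-- cardinality of the ball -/
noncomputable def ball (n : ℤ) : Finset G := (m.fin n).toFinset

theorem mem_ball (n : ℤ) (g : G) : g ∈ m.ball n ↔ m.d 1 g ≤ n := by simp [ball]

theorem exists_p (R C : ℤ) (hC : C = 10 * R + 10 * m.D + 10) (y t : G)
    (ht : m.d 1 t ≤ R) (hg : C ≤ m.gp 1 (t * y) y) :
    ∃ p, m.d 1 p = R + m.D + 1 ∧ m.d p y = m.d 1 y - (R + m.D + 1) := by
  have hR : 0 ≤ R := le_trans (m.nonneg _ _) ht
  have hD := m.D_nonneg
  apply m.geo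
  · omega
  · have := m.tri 1 y (t * y)
    have := m.symm (t * y) y
    unfold gp at hg
    omega

theorem count_fin (R C : ℤ) (hC : C = 10 * R + 10 * m.D + 10) (y : G) (Z : Finset G)
    (ht : ∀ t ∈ Z, m.d 1 t ≤ R) (hg : ∀ t ∈ Z, C ≤ m.gp 1 (t * y) y)
    (hf : ∀ t ∈ Z, IsOfFinOrder t) : Z.card ≤ (m.ball (8 * m.D)).card := by
  rcases Z.eq_empty_or_nonempty with rfl | ⟨t0, ht0⟩
  · simp
  obtain ⟨p, hp1, hp2⟩ := m.exists_p R C hC y t0 (ht _ ht0) (hg _ ht0)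
  apply Finset.card_le_card_of_injOn (fun t => p⁻¹ * (t * p))
  · intro t h
    have := m.config_fin R C hC y p t hp1 hp2 (ht _ h) (hg _ h) (hf _ h)
    simp only [Finset.mem_coe, mem_ball]
    rwa [m.inv_one_left]
  · intro a _ b _ hab
    simpa using hab

theorem count_lin (R C : ℤ) (hC : C = 10 * R + 10 * m.D + 10) (y : G) (Z : Finset G)
    (ht : ∀ t ∈ Z, m.d 1 t ≤ R) (hg : ∀ t ∈ Z, C ≤ m.gp 1 (t * y) y) :
    Z.card ≤ (m.ball (3 * m.D)).card * (6 * R + 4 * m.D + 5).toNat := by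
  rcases Z.eq_empty_or_nonempty with rfl | ⟨t0, ht0⟩
  · simp
  have hR : 0 ≤ R := le_trans (m.nonneg _ _) (ht _ ht0)
  have hD := m.D_nonneg
  obtain ⟨p, hp1, hp2⟩ := m.exists_p R C hC y t0 (ht _ ht0) (hg _ ht0)
  classical
  have hmaps : ∀ t ∈ Z, m.d (t * p) y - m.d p y ∈
      Finset.Icc (-(3 * R + 2 * m.D + 2)) (3 * R + 2 * m.D + 2) := by
    intro t h
    have t1 := m.tri p 1 (t * p)
    have t2 := m.tri 1 t (t * p)
    have t3 := m.d_mul_right t p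
    have s2 := m.symm 1 p
    have t4 := m.tri p (t * p) y
    have t5 := m.tri (t * p) p y
    have s3 := m.symm p (t * p)
    have := ht t h
    rw [Finset.mem_Icc]
    omega
  have := Finset.card_le_mul_card_image_of_maps_to (s := Z)
    (t := Finset.Icc (-(3 * R + 2 * m.D + 2)) (3 * R + 2 * m.D + 2))
    (f := fun t => m.d (t * p) y - m.d p y) hmaps (m.ball (3 * m.D)).card ?_
  · rw [Int.card_Icc] at this
    convert this using 3
    ring
  · intro b _
    rcases (Z.filter (fun t => m.d (t * p) y - m.d p y = b)).eq_empty_or_nonempty with h | ⟨a, ha⟩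
    · rw [h]; simp
    apply Finset.card_le_card_of_injOn (fun t => (a * p)⁻¹ * (t * p))
    · intro t h
      simp only [Finset.coe_filter, Set.mem_ofPred_eq] at h
      rw [Finset.mem_filter] at ha
      have c1 := m.config R C hC y p t hp1 hp2 (ht _ h.1) (hg _ h.1)
      have c2 := m.config R C hC y p a hp1 hp2 (ht _ ha.1) (hg _ ha.1)
      have c3 := m.config_dist y _ _ c2 c1
      have : m.d (a * p) y - m.d (t * p) y = 0 := by omega
      rw [this] at c3
      simp only [Finset.mem_coe, mem_ball, m.inv_one_left]
      simpa using c3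
    · intro a _ b _ hab
      simpa using hab

def Sep (H : Subgroup G) (k : ℕ) : Prop :=
  ∃ R C : ℤ, ∀ X : Finset G, X.card ≤ k → ∀ y y' : G, ∃ s ∈ H, m.d 1 s ≤ R ∧
    ∀ x ∈ X, m.gp 1 x (s * y) ≤ C ∧ m.gp 1 x (s * y') ≤ C

theorem not_sep (H : Subgroup G) (k : ℕ) (h : ¬ m.Sep H k) (R : ℤ) (N : ℕ)
    (hN : ∀ (y : G) (Z : Finset G), (∀ t ∈ Z, t ∈ H) → (∀ t ∈ Z, m.d 1 t ≤ 2 * R) →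
      (∀ t ∈ Z, 10 * (2 * R) + 10 * m.D + 10 ≤ m.gp 1 (t * y) y) → Z.card ≤ N)
    (B : Finset G) (hB : ∀ t ∈ B, t ∈ H ∧ m.d 1 t ≤ R) : B.card ≤ N * (2 * k) := by
  classical
  unfold Sep at h
  push Not at h
  obtain ⟨X, hX, y, y', hs⟩ := h R (10 * (2 * R) + 10 * m.D + 10 + m.D + 2 * R)
  have hs' : ∀ s ∈ B, ∃ q ∈ X ×ˢ ({y, y'} : Finset G),
      10 * (2 * R) + 10 * m.D + 10 + m.D + 2 * R < m.gp 1 q.1 (s * q.2) := by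
    intro s hsB
    obtain ⟨x, hx, hxx⟩ := hs s (hB s hsB).1 (hB s hsB).2
    by_cases h1 : m.gp 1 x (s * y) ≤ 10 * (2 * R) + 10 * m.D + 10 + m.D + 2 * R
    · exact ⟨(x, y'), by simp [hx], hxx h1⟩
    · exact ⟨(x, y), by simp [hx], not_le.1 h1⟩
  choose! φ hφ1 hφ2 using hs'
  have hcard : (X ×ˢ ({y, y'} : Finset G)).card ≤ 2 * k := by
    rw [Finset.card_product]
    have : ({y, y'} : Finset G).card ≤ 2 := Finset.card_le_two
    nlinarith
  refine le_trans (Finset.card_le_mul_card_image_of_maps_to (f := φ) hφ1 N ?_)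
    (Nat.mul_le_mul_left _ hcard)
  intro q _
  rcases (B.filter (fun t => φ t = q)).eq_empty_or_nonempty with h | ⟨a, ha⟩
  · rw [h]; simp
  rw [Finset.mem_filter] at ha
  have hinj : Function.Injective (fun t : G => a⁻¹ * t) := fun _ _ h => by simpa using h
  rw [← Finset.card_image_of_injective _ hinj]
  apply hN q.2
  · intro t ht
    obtain ⟨s, hs, rfl⟩ := Finset.mem_image.1 ht
    rw [Finset.mem_filter] at hs
    exact H.mul_mem (H.inv_mem (hB _ ha.1).1) (hB _ hs.1).1
  · intro t ht
    obtain ⟨s, hs, rfl⟩ := Finset.mem_image.1 ht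
    rw [Finset.mem_filter] at hs
    have h1 := (hB _ ha.1).2
    have h2 := (hB _ hs.1).2
    have h3 := m.tri a 1 s
    have h4 := m.symm a 1
    simp only [m.inv_one_left]
    omega
  · intro t ht
    obtain ⟨s, hs, rfl⟩ := Finset.mem_image.1 ht
    rw [Finset.mem_filter] at hs
    have h1 := (hB _ ha.1).2
    have e1 : m.gp 1 (a⁻¹ * s * q.2) q.2 = m.gp a (s * q.2) (a * q.2) := by
      unfold gp
      rw [mul_assoc, m.inv_one_left, m.d_mul_right]
      congr 1
      rw [← m.inv a]; simp
    have f1 := hφ2 _ ha.1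
    have f2 := hφ2 _ hs.1
    rw [ha.2] at f1
    rw [hs.2] at f2
    have g1 := m.gp_four 1 (s * q.2) q.1 (a * q.2)
    rw [m.gp_comm 1 (s * q.2) q.1] at g1
    have g2 := m.tri 1 a (s * q.2)
    have g3 := m.tri 1 a (a * q.2)
    rw [e1]
    unfold gp at *
    omega

theorem not_sep_lin (H : Subgroup G) (k : ℕ) (h : ¬ m.Sep H k) :
    ∃ M : ℕ, ∀ R : ℕ, ∀ B : Finset G, (∀ t ∈ B, t ∈ H ∧ m.d 1 t ≤ R) →
      B.card ≤ M * (R + 1) := by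
  have hD := m.D_nonneg
  refine ⟨(m.ball (3 * m.D)).card * (12 + (4 * m.D + 5).toNat) * (2 * k), fun R B hB => ?_⟩
  refine (m.not_sep H k h R ((m.ball (3 * m.D)).card * (6 * (2 * R) + 4 * m.D + 5).toNat) ?_
    B hB).trans ?_
  · intro y Z _ h2 h3
    exact m.count_lin (2 * R) _ rfl y Z h2 h3
  · have : (6 * (2 * (R : ℤ)) + 4 * m.D + 5).toNat ≤ (12 + (4 * m.D + 5).toNat) * (R + 1) := by
      have : (6 * (2 * (R : ℤ)) + 4 * m.D + 5).toNat = 12 * R + (4 * m.D + 5).toNat := by omega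
      rw [this]
      nlinarith [Nat.zero_le ((4 * m.D + 5).toNat * R)]
    calc _ ≤ (m.ball (3 * m.D)).card * ((12 + (4 * m.D + 5).toNat) * (R + 1)) * (2 * k) := by
          gcongr
      _ = _ := by ring

theorem not_sep_fin (H : Subgroup G) (k : ℕ) (h : ¬ m.Sep H k)
    (hf : ∀ t ∈ H, IsOfFinOrder t) : (H : Set G).Finite := by
  by_contra hinf
  obtain ⟨B, hBH, hBc⟩ := Set.Infinite.exists_subset_card_eq hinf
    ((m.ball (8 * m.D)).card * (2 * k) + 1)
  obtain ⟨R, hR⟩ : ∃ R : ℤ, ∀ t ∈ B, m.d 1 t ≤ R := by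
    obtain ⟨R, hR⟩ := (B.image (fun t => m.d 1 t)).bddAbove
    exact ⟨R, fun t ht => hR (by simpa using ⟨t, ht, rfl⟩)⟩
  have := m.not_sep H k h R ((m.ball (8 * m.D)).card) (by
    intro y Z h1 h2 h3
    exact m.count_fin (2 * R) _ rfl y Z h2 h3 (fun t ht => hf t (h1 t ht))) B
    (fun t ht => ⟨hBH ht, hR t ht⟩)
  omega

theorem gp_transfer (x A g : G) (c : ℤ) (h1 : m.gp 1 x A ≤ c) (h2 : c + m.D < m.gp 1 A g) :
    m.gp 1 x g ≤ c + m.D := by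
  have := m.gp_four 1 x g A
  have := m.gp_comm 1 g A
  omega

theorem chain_word {α : Type*} (L : α → G) (r : α → α → Prop) (c : ℤ) (hc0 : 0 ≤ c)
    (hr : ∀ a b, r a b → m.gp 1 (L a)⁻¹ (L b) ≤ c)
    (hL : ∀ a, c + m.D < m.d 1 (L a)) (l : List α) :
    ∀ a, List.IsChain r (a :: l) →
      2 * m.d 1 (L a) - c - m.D ≤ m.gp 1 (L a) ((a :: l).map L).prod := by
  have hD := m.D_nonneg
  induction l with
  | nil =>
    intro a _
    have h0 := m.self (L a)
    have h1 := m.nonneg 1 (L a)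
    simp only [List.map_cons, List.map_nil, List.prod_cons, List.prod_nil, mul_one, gp, h0]
    omega
  | cons b l ih =>
    intro a hc
    rw [List.isChain_cons_cons] at hc
    have h1 := ih b hc.2
    have h2 := hr a b hc.1
    have h3 := hL b
    set w := ((b :: l).map L).prod with hw
    have e : ((a :: b :: l).map L).prod = L a * w := by simp [hw]
    rw [e]
    have h4 := m.gp_transfer (L a)⁻¹ (L b) w c h2 (by omega)
    have e1 : m.d (L a)⁻¹ w = m.d 1 (L a * w) := by
      rw [← m.inv (L a)]; simp
    have e2 := m.d_mul_right (L a) w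
    have e3 := m.d_inv (L a)
    unfold gp at *
    omega

theorem step (H F : Subgroup G) (hFH : F ≤ H) (hn : ∀ s ∈ H, ∀ f ∈ F, s * f * s⁻¹ ∈ F)
    (hinf : (F : Set G).Infinite) (k : ℕ) (hsep : m.Sep H (k + 2)) (E : ℤ) :
    ∃ c : ℤ, 0 ≤ c ∧ ∀ L : ℤ, ∀ h ∈ H, m.d 1 h ≤ E → ∀ X : Finset G, X.card ≤ k →
      ∃ g, h⁻¹ * g ∈ F ∧ L ≤ m.d 1 g ∧ m.gp 1 g⁻¹ g ≤ c ∧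
        ∀ x ∈ X, m.gp 1 x g ≤ c ∧ m.gp 1 x g⁻¹ ≤ c := by
  classical
  obtain ⟨R, C, hRC⟩ := hsep
  have hD := m.D_nonneg
  refine ⟨|C| + 2 * |E| + 2 * m.D, by positivity, ?_⟩
  intro L h hh hE X hX
  have hC := le_abs_self C
  have hE' := le_abs_self E
  have hC0 := abs_nonneg C
  have hE0 := abs_nonneg E
  -- a long element
  obtain ⟨f, hfF, hf⟩ : ∃ f ∈ F, |L| + 20 * |R| + 20 * |E| + 20 * |C| + 20 * m.D + 20 < m.d 1 f := by
    by_contra hcon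
    push Not at hcon
    exact hinf ((m.fin _).subset (fun f hf => hcon f hf))
  have hL := le_abs_self L
  have hL0 := abs_nonneg L
  have hR := le_abs_self R
  have hR0 := abs_nonneg R
  obtain ⟨s, hsH, hsR, hs⟩ := hRC (X.image (fun x => h⁻¹ * x))
    (Finset.card_image_le.trans (by omega)) f f
  obtain ⟨t, htH, htR, ht⟩ := hRC (insert (h * (s * f)) (insert (s * f⁻¹) X))
    ((Finset.card_insert_le _ _).trans
      (Nat.succ_le_succ ((Finset.card_insert_le _ _).trans (Nat.succ_le_succ hX)))) f⁻¹ f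
  have hAQ := (ht (h * (s * f)) (by simp)).1
  have hst := (ht (s * f⁻¹) (by simp)).2
  set A := h * (s * f) with hA
  set Q := t * f⁻¹ with hQ
  set g := h * (s * f * s⁻¹ * (t * f * t⁻¹)) with hg
  -- lengths
  have df := m.d_inv f
  have dh := m.d_inv h
  have ds := m.d_inv s
  have dt := m.d_inv t
  have a1 := m.d_mul_right h (s * f)
  have a2 := m.d_mul_right s f
  have a3 := m.d_mul_right t f⁻¹
  have a4 := m.d_mul_right s f⁻¹
  have a5 := m.d_mul_right t f
  -- d 1 A
  have b1 : m.d 1 f - E - R ≤ m.d 1 A := by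
    have t1 := m.tri h 1 A
    have t2 := m.tri s 1 (s * f)
    have s1 := m.symm h 1
    have s2 := m.symm s 1
    rw [← hA] at a1
    omega
  have b2 : m.d 1 f - R ≤ m.d 1 Q := by
    have t1 := m.tri t 1 Q
    have s1 := m.symm t 1
    rw [← hQ] at a3
    omega
  have b3 : 2 * m.d 1 f - 4 * R - E - C ≤ m.d 1 g := by
    have t1 := m.tri h 1 g
    have s1 := m.symm h 1
    have e1 := m.d_mul_right h (s * f * s⁻¹ * (t * f * t⁻¹))
    rw [← hg] at e1
    have e2 : m.d 1 (s * f * s⁻¹ * (t * f * t⁻¹)) = m.d (s * f⁻¹ * s⁻¹) (t * f * t⁻¹) := by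
      rw [← m.inv (s * f * s⁻¹) (s * f⁻¹ * s⁻¹)]
      congr 1
      group
    have t2 := m.tri (s * f⁻¹) (s * f⁻¹ * s⁻¹) (t * f)
    have t3 := m.tri (s * f⁻¹ * s⁻¹) (t * f * t⁻¹) (t * f)
    have e3 := m.d_mul_right (s * f⁻¹) s⁻¹
    have e4 := m.d_mul_right (t * f) t⁻¹
    have s2 := m.symm (t * f) (t * f * t⁻¹)
    have t4 := m.tri s 1 (s * f⁻¹)
    have t5 := m.tri t 1 (t * f)
    have s3 := m.symm s 1
    have s4 := m.symm t 1
    unfold gp at hst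
    omega
  have b4 : m.d A g ≤ m.d 1 f + 3 * R := by
    have e1 : g = A * (s⁻¹ * (t * (f * t⁻¹))) := by rw [hg, hA]; group
    have e2 := m.d_mul_right A (s⁻¹ * (t * (f * t⁻¹)))
    rw [← e1] at e2
    have t1 := m.tri 1 s⁻¹ (s⁻¹ * (t * (f * t⁻¹)))
    have t2 := m.tri 1 t (t * (f * t⁻¹))
    have t3 := m.tri 1 f (f * t⁻¹)
    simp only [m.d_mul_right] at t1 t2 t3
    omega
  have b5 : m.d Q g⁻¹ ≤ m.d 1 f + 3 * R + E := by
    have e1 : g⁻¹ = Q * (t⁻¹ * (s * (f⁻¹ * (s⁻¹ * h⁻¹)))) := by rw [hg, hQ]; group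
    have e2 := m.d_mul_right Q (t⁻¹ * (s * (f⁻¹ * (s⁻¹ * h⁻¹))))
    rw [← e1] at e2
    have t1 := m.tri 1 t⁻¹ (t⁻¹ * (s * (f⁻¹ * (s⁻¹ * h⁻¹))))
    have t2 := m.tri 1 s (s * (f⁻¹ * (s⁻¹ * h⁻¹)))
    have t3 := m.tri 1 f⁻¹ (f⁻¹ * (s⁻¹ * h⁻¹))
    have t4 := m.tri 1 s⁻¹ (s⁻¹ * h⁻¹)
    simp only [m.d_mul_right] at t1 t2 t3 t4
    omega
  have dg := m.d_inv g
  have c1 : |C| + 2 * |E| + 2 * m.D < m.gp 1 A g := by unfold gp; omega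
  have c2 : |C| + 2 * |E| + 2 * m.D < m.gp 1 Q g⁻¹ := by unfold gp; omega
  refine ⟨g, ?_, by omega, ?_, ?_⟩
  · rw [hg, inv_mul_cancel_left]
    exact F.mul_mem (hn s hsH f hfF) (hn t htH f hfF)
  · have h1 := m.gp_transfer A Q g⁻¹ C hAQ (by omega)
    rw [m.gp_comm] at h1
    have h2 := m.gp_transfer g⁻¹ A g (C + m.D) h1 (by omega)
    omega
  · intro x hx
    constructor
    · have h1 := (hs (h⁻¹ * x) (Finset.mem_image_of_mem _ hx)).1
      have h2 : m.gp 1 x A ≤ C + 2 * E := by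
        have e1 : m.d (h⁻¹ * x) (s * f) = m.d x A := by
          rw [← m.inv h]; simp [hA]
        have e2 := m.inv_one_left h x
        have t1 := m.tri 1 h x
        have t2 := m.tri 1 h A
        rw [← hA] at a1
        unfold gp at *
        omega
      have h3 := m.gp_transfer x A g _ h2 (by omega)
      omega
    · have h1 := (ht x (by simp [hx])).1
      have h3 := m.gp_transfer x Q g⁻¹ _ h1 (by omega)
      omega

theorem exists_seq (H F : Subgroup G) (hFH : F ≤ H) (hn : ∀ s ∈ H, ∀ f ∈ F, s * f * s⁻¹ ∈ F)
    (hinf : (F : Set G).Infinite) (n : ℕ) (hsep : m.Sep H (2 * n + 2)) (h : ℕ → G)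
    (hh : ∀ i, h i ∈ H) :
    ∃ c : ℤ, 0 ≤ c ∧ ∀ L : ℤ, ∃ g : ℕ → G, ∀ i < n, ((h i)⁻¹ * g i ∈ F ∧ L ≤ m.d 1 (g i) ∧
      m.gp 1 (g i)⁻¹ (g i) ≤ c ∧ ∀ j < i, (m.gp 1 (g j) (g i) ≤ c ∧ m.gp 1 (g j) (g i)⁻¹ ≤ c ∧
      m.gp 1 (g j)⁻¹ (g i) ≤ c ∧ m.gp 1 (g j)⁻¹ (g i)⁻¹ ≤ c)) := by
  classical
  obtain ⟨E, hE⟩ : ∃ E : ℤ, ∀ i < n, m.d 1 (h i) ≤ E := by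
    obtain ⟨R, hR⟩ := ((Finset.range n).image (fun i => m.d 1 (h i))).bddAbove
    exact ⟨R, fun t ht => hR (by simpa using ⟨t, ht, rfl⟩)⟩
  obtain ⟨c, hc0, hc⟩ := m.step H F hFH hn hinf (2 * n) hsep E
  refine ⟨c, hc0, fun L => ?_⟩
  suffices hk : ∀ k ≤ n, ∃ g : ℕ → G, ∀ i < k, ((h i)⁻¹ * g i ∈ F ∧ L ≤ m.d 1 (g i) ∧
      m.gp 1 (g i)⁻¹ (g i) ≤ c ∧ ∀ j < i, (m.gp 1 (g j) (g i) ≤ c ∧ m.gp 1 (g j) (g i)⁻¹ ≤ c ∧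
      m.gp 1 (g j)⁻¹ (g i) ≤ c ∧ m.gp 1 (g j)⁻¹ (g i)⁻¹ ≤ c)) from hk n le_rfl
  intro k
  induction k with
  | zero => exact fun _ => ⟨fun _ => 1, by simp⟩
  | succ k ih =>
    intro hk
    obtain ⟨g, hg⟩ := ih (by omega)
    obtain ⟨u, hu1, hu2, hu3, hu4⟩ := hc L (h k) (hh k) (hE k (by omega))
      ((Finset.range k).image g ∪ (Finset.range k).image (fun i => (g i)⁻¹)) (by
        refine (Finset.card_union_le _ _).trans ?_
        have h1 := Finset.card_image_le (s := Finset.range k) (f := g)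
        have h2 := Finset.card_image_le (s := Finset.range k) (f := fun i => (g i)⁻¹)
        rw [Finset.card_range] at h1 h2
        omega)
    refine ⟨Function.update g k u, fun i hi => ?_⟩
    rcases Nat.lt_succ_iff_lt_or_eq.1 hi with hi | rfl
    · have := hg i hi
      rw [Function.update_of_ne (by omega)]
      refine ⟨this.1, this.2.1, this.2.2.1, fun j hj => ?_⟩
      rw [Function.update_of_ne (by omega)]
      exact this.2.2.2 j hj
    · rw [Function.update_self]
      refine ⟨hu1, hu2, hu3, fun j hj => ?_⟩
      rw [Function.update_of_ne (by omega)]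
      have h1 := hu4 (g j) (Finset.mem_union_left _
        (Finset.mem_image_of_mem _ (Finset.mem_range.2 hj)))
      have h2 := hu4 (g j)⁻¹ (Finset.mem_union_right _
        (Finset.mem_image.2 ⟨j, Finset.mem_range.2 hj, rfl⟩))
      exact ⟨h1.1, h1.2, h2.1, h2.2⟩

theorem pingpong (H F : Subgroup G) (hFH : F ≤ H) (hn : ∀ s ∈ H, ∀ f ∈ F, s * f * s⁻¹ ∈ F)
    (hinf : (F : Set G).Infinite) (n : ℕ) (hsep : m.Sep H (2 * n + 2)) (h : ℕ → G)
    (hh : ∀ i, h i ∈ H) (e : G) (he : e ≠ 1) :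
    ∃ g : Fin n → G, (∀ i : Fin n, (h i)⁻¹ * g i ∈ F) ∧ e ∉ Subgroup.closure (Set.range g) := by
  classical
  obtain ⟨c, hc0, hc⟩ := m.exists_seq H F hFH hn hinf n hsep h hh
  have hD := m.D_nonneg
  obtain ⟨g, hg⟩ := hc (c + m.D + 1 + m.d 1 e)
  have he0 := m.nonneg 1 e
  refine ⟨fun i => g i, fun i => (hg i i.2).1, ?_⟩
  rw [← FreeGroup.range_lift_eq_closure]
  rintro ⟨w, hw⟩
  rw [← FreeGroup.mk_toWord (x := w), FreeGroup.lift_mk] at hw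
  have hred := FreeGroup.isReduced_toWord (x := w)
  unfold FreeGroup.IsReduced at hred
  generalize w.toWord = l at hw hred
  cases l with
  | nil => exact he (by simpa using hw.symm)
  | cons a l =>
    have key := m.chain_word (fun x : Fin n × Bool => cond x.2 (g x.1) (g x.1)⁻¹) _ c hc0 ?_ ?_ l a hred
    · rw [hw] at key
      have h1 : c + m.D + 1 + m.d 1 e ≤ m.d 1 (cond a.2 (g a.1) (g a.1)⁻¹) := by
        rcases a with ⟨a, _ | _⟩
        · simpa [m.d_inv] using (hg a a.2).2.1
        · simpa using (hg a a.2).2.1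
      have h2 := m.tri 1 e (cond a.2 (g a.1) (g a.1)⁻¹)
      have h3 := m.symm e (cond a.2 (g a.1) (g a.1)⁻¹)
      unfold gp at key
      omega
    · rintro ⟨a, ε⟩ ⟨b, ε'⟩ hab
      simp only at hab
      rcases lt_trichotomy (a : ℕ) (b : ℕ) with hlt | heq | hlt
      · have := (hg b b.2).2.2.2 a hlt
        rcases ε <;> rcases ε' <;> simp [this]
      · have heq' : a = b := Fin.ext heq
        subst heq'
        have := (hg a a.2).2.2.1
        rw [← hab rfl]
        rcases ε
        · simp only [cond_false, inv_inv]
          rwa [m.gp_comm]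
        · simpa using this
      · have := (hg a a.2).2.2.2 b hlt
        rw [m.gp_comm]
        rcases ε <;> rcases ε' <;> simp [this]
    · rintro ⟨a, _ | _⟩
      · have := (hg a a.2).2.1
        simp only [cond_false, m.d_inv]
        omega
      · have := (hg a a.2).2.1
        simp only [cond_true]
        omega

theorem finiteIndex_zpowers (H : Subgroup G) (M : ℕ)
    (hM : ∀ R : ℕ, ∀ B : Finset G, (∀ t ∈ B, t ∈ H ∧ m.d 1 t ≤ R) → B.card ≤ M * (R + 1))
    (z : H) (hz : ¬ IsOfFinOrder z) : (Subgroup.zpowers z).FiniteIndex := by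
  classical
  rw [Subgroup.finiteIndex_iff_finite_quotient]
  by_contra hinf
  rw [not_finite_iff_infinite] at hinf
  obtain ⟨a, ha⟩ : ∃ a : ℕ, m.d 1 (z : G) = a := ⟨_, (Int.toNat_of_nonneg (m.nonneg _ _)).symm⟩
  obtain ⟨T, hT⟩ := Infinite.exists_subset_card_eq (H ⧸ Subgroup.zpowers z) (M * a + 1)
  obtain ⟨r, hr⟩ : ∃ r : ℕ, ∀ q ∈ T, m.d 1 (q.out : G) ≤ r := by
    obtain ⟨R, hR⟩ := (T.image (fun q => m.d 1 ((q.out : H) : G))).bddAbove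
    refine ⟨R.toNat, fun t ht => ?_⟩
    have := hR (a := m.d 1 ((t.out : H) : G)) (by simpa using ⟨t, ht, rfl⟩)
    omega
  have hlen : ∀ j : ℕ, m.d 1 ((z : G) ^ j) ≤ j * a := by
    intro j
    induction j with
    | zero => simp [m.self]
    | succ j ih =>
      have t1 := m.tri 1 ((z : G) ^ j) ((z : G) ^ j * z)
      rw [m.d_mul_right, ha] at t1
      rw [pow_succ]
      push_cast
      linarith
  set J := M * (r + 1) + 1 with hJ
  have hinj : Function.Injective (fun x : (H ⧸ Subgroup.zpowers z) × ℕ =>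
      ((x.1.out * z ^ x.2 : H) : G)) := by
    rintro ⟨q, i⟩ ⟨q', j⟩ h
    have h : q.out * z ^ i = q'.out * z ^ j := Subtype.ext h
    have hq : q = q' := by
      rw [← q.out_eq', ← q'.out_eq']
      rw [QuotientGroup.eq]
      have : q.out⁻¹ * q'.out = z ^ i * (z ^ j)⁻¹ := by
        rw [eq_mul_inv_iff_mul_eq, mul_assoc, ← h, inv_mul_cancel_left]
      rw [this]
      exact Subgroup.mul_mem _ (Subgroup.npow_mem_zpowers _ _)
        (Subgroup.inv_mem _ (Subgroup.npow_mem_zpowers _ _))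
    subst hq
    have h2 : z ^ i = z ^ j := mul_left_cancel h
    have := (injective_pow_iff_not_isOfFinOrder.2 hz) h2
    rw [this]
  have hcard := hM (r + J * a) ((T ×ˢ Finset.range J).image
    (fun x => ((x.1.out * z ^ x.2 : H) : G))) (by
      intro t ht
      obtain ⟨⟨q, j⟩, hx, rfl⟩ := Finset.mem_image.1 ht
      rw [Finset.mem_product, Finset.mem_range] at hx
      refine ⟨Subtype.prop _, ?_⟩
      have t1 := m.tri 1 (q.out : G) ((q.out : G) * (z : G) ^ j)
      rw [m.d_mul_right] at t1
      have t2 := hlen j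
      have t3 := hr q hx.1
      have t4 : (j : ℤ) * a ≤ J * a := by
        have := hx.2.le
        gcongr
      simp only [Subgroup.coe_mul, Subgroup.coe_pow]
      push_cast at *
      linarith)
  rw [Finset.card_image_of_injective _ hinj, Finset.card_product, Finset.card_range, hT] at hcard
  have : (M * a + 1) * J = M * (J * a) + J := by ring
  have : M * (r + J * a + 1) = M * (J * a) + M * (r + 1) := by ring
  omega

end HypMetric

theorem coatomic_of_fg (Γ : Type*) [Group Γ] (h : Group.FG Γ) : IsCoatomic (Subgroup Γ) := by
  apply CompleteLattice.coatomic_of_top_compact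
  obtain ⟨S, hS⟩ := (Group.fg_def.1 h)
  rw [CompleteLattice.isCompactElement_iff_le_of_directed_sSup_le]
  intro s hne hdir htop
  have hS' : ∀ T : Finset Γ, ∃ K ∈ s, (T : Set Γ) ⊆ K := by
    classical
    intro T
    induction T using Finset.induction_on with
    | empty =>
      obtain ⟨K, hK⟩ := hne
      exact ⟨K, hK, by simp⟩
    | insert a T _ ih =>
      obtain ⟨K, hK, hTK⟩ := ih
      have ha : a ∈ sSup s := htop trivial
      rw [Subgroup.mem_sSup_of_directedOn hne hdir] at ha
      obtain ⟨K', hK', haK'⟩ := ha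
      obtain ⟨K'', hK'', h1, h2⟩ := hdir K hK K' hK'
      refine ⟨K'', hK'', ?_⟩
      rw [Finset.coe_insert, Set.insert_subset_iff]
      exact ⟨h2 haK', hTK.trans h1⟩
  obtain ⟨K, hK, hSK⟩ := hS' S
  refine ⟨K, hK, ?_⟩
  rw [← hS]
  exact (Subgroup.closure_le K).2 hSK

theorem frattini_finite_of_vcyclic {Γ : Type*} [Group Γ] [IsCoatomic (Subgroup Γ)] (z : Γ)
    (hz : ¬ IsOfFinOrder z) (hfi : (Subgroup.zpowers z).FiniteIndex) :
    (frattini Γ : Set Γ).Finite := by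
  by_contra hinf
  -- normal cyclic finite index
  obtain ⟨w, hw⟩ : ∃ w : Γ, (Subgroup.zpowers z).normalCore = Subgroup.zpowers w := by
    have hle := Subgroup.normalCore_le (Subgroup.zpowers z)
    have : IsCyclic ((Subgroup.zpowers z).normalCore.subgroupOf (Subgroup.zpowers z)) := inferInstance
    have : IsCyclic (Subgroup.zpowers z).normalCore :=
      isCyclic_of_surjective (Subgroup.subgroupOfEquivOfLe hle)
        (Subgroup.subgroupOfEquivOfLe hle).surjective
    obtain ⟨w, hw⟩ := (Subgroup.isCyclic_iff_exists_zpowers_eq_top _).1 this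
    exact ⟨w, hw.symm⟩
  have hN0 : (Subgroup.zpowers w).Normal := hw ▸ Subgroup.normalCore_normal _
  have hN1 : (Subgroup.zpowers w).FiniteIndex := by
    rw [← hw]; infer_instance
  have hwinf : ¬ IsOfFinOrder w := by
    intro hwf
    have hfin : Finite (Subgroup.zpowers w) := by
      exact (finite_zpowers.2 hwf).to_subtype
    have : Finite Γ := by
      apply Nat.finite_of_card_ne_zero
      rw [← (Subgroup.zpowers w).card_mul_index]
      exact mul_ne_zero Nat.card_pos.ne' hN1.index_ne_zero
    exact hz (isOfFinOrder_of_finite z)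
  -- frattini meets it
  obtain ⟨k, hk0, hk⟩ : ∃ k : ℤ, k ≠ 0 ∧ w ^ k ∈ frattini Γ := by
    have hq : Finite (Γ ⧸ Subgroup.zpowers w) := inferInstance
    have hinf' : Infinite (frattini Γ) := Set.infinite_coe_iff.2 hinf
    obtain ⟨a, b, hab, he⟩ := Finite.exists_ne_map_eq_of_infinite
      (fun x : frattini Γ => ((x : Γ) : Γ ⧸ Subgroup.zpowers w))
    have he := QuotientGroup.eq.1 he
    obtain ⟨k, hk⟩ := Subgroup.mem_zpowers_iff.1 he
    refine ⟨k, ?_, ?_⟩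
    · rintro rfl
      apply hab
      rw [zpow_zero] at hk
      exact Subtype.ext (inv_mul_eq_one.1 hk.symm)
    · rw [hk]
      exact Subgroup.mul_mem _ (Subgroup.inv_mem _ a.2) b.2
  obtain ⟨p, hpge, hp⟩ := Nat.exists_infinite_primes (k.natAbs + (Subgroup.zpowers w).index + 1)
  have hpk : IsCoprime (p : ℤ) k := by
    rw [Int.isCoprime_iff_nat_coprime, Int.natAbs_natCast]
    rw [Nat.Prime.coprime_iff_not_dvd hp]
    intro hd
    have := Nat.le_of_dvd (Int.natAbs_pos.2 hk0) hd
    omega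
  have hpi : Nat.Coprime p (Subgroup.zpowers w).index := by
    rw [Nat.Prime.coprime_iff_not_dvd hp]
    intro hd
    have := Nat.le_of_dvd (Nat.pos_of_ne_zero hN1.index_ne_zero) hd
    omega
  have hP : (Subgroup.zpowers (w ^ p)).Normal := by
    constructor
    intro n hn g
    obtain ⟨i, rfl⟩ := Subgroup.mem_zpowers_iff.1 hn
    obtain ⟨j, hj⟩ := Subgroup.mem_zpowers_iff.1
      (hN0.conj_mem w (Subgroup.mem_zpowers w) g)
    rw [Subgroup.mem_zpowers_iff]
    refine ⟨j * i, ?_⟩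
    rw [← conj_zpow, ← conj_pow, ← hj, ← zpow_natCast, ← zpow_natCast, ← zpow_mul, ← zpow_mul,
      ← zpow_mul]
    congr 1
    ring
  have hwP : w ∉ Subgroup.zpowers (w ^ p) := by
    intro hmem
    obtain ⟨i, hi⟩ := Subgroup.mem_zpowers_iff.1 hmem
    rw [← zpow_natCast, ← zpow_mul] at hi
    have h1 := (injective_zpow_iff_not_isOfFinOrder.2 hwinf) (hi.trans (zpow_one w).symm)
    have h2 : (p : ℤ) ∣ 1 := ⟨i, h1.symm⟩
    exact hp.one_lt.ne' (by exact_mod_cast Int.eq_one_of_dvd_one (by positivity) h2)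
  let π := QuotientGroup.mk' (Subgroup.zpowers (w ^ p))
  have hπs : Function.Surjective π := QuotientGroup.mk'_surjective _
  have hker : π.ker = Subgroup.zpowers (w ^ p) := QuotientGroup.ker_mk' _
  let N := (Subgroup.zpowers w).map π
  have hNn : N.Normal := hN0.map π hπs
  have hNz : N = Subgroup.zpowers (π w) := MonoidHom.map_zpowers π w
  have hNi : N.index = (Subgroup.zpowers w).index := by
    apply Subgroup.index_map_eq _ hπs
    rw [hker, Subgroup.zpowers_le]
    exact Subgroup.npow_mem_zpowers _ _
  have hπw : π w ≠ 1 := by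
    rw [Ne, ← MonoidHom.mem_ker, hker]
    exact hwP
  have hNc : Nat.card N = p := by
    rw [hNz, Nat.card_zpowers]
    have := Fact.mk hp
    apply orderOf_eq_prime _ hπw
    rw [← map_pow, ← MonoidHom.mem_ker, hker]
    exact Subgroup.mem_zpowers _
  obtain ⟨K, hK⟩ := Subgroup.exists_right_complement'_of_coprime (N := N)
    (by rw [hNc, hNi]; exact hpi)
  have htop : K.comap π ⊔ frattini Γ = ⊤ := by
    have hPK : w ^ p ∈ K.comap π ⊔ frattini Γ := by
      apply Subgroup.mem_sup_left
      rw [Subgroup.mem_comap]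
      have : π (w ^ p) = 1 := by
        rw [← MonoidHom.mem_ker, hker]
        exact Subgroup.mem_zpowers _
      rw [this]
      exact K.one_mem
    have hw1 : w ∈ K.comap π ⊔ frattini Γ := by
      obtain ⟨a, b, hab⟩ := hpk
      have : w = (w ^ p) ^ a * (w ^ k) ^ b := by
        rw [← zpow_natCast, ← zpow_mul, ← zpow_mul, ← zpow_add, mul_comm (p : ℤ), mul_comm k, hab,
          zpow_one]
      have hmem := Subgroup.mul_mem _ (Subgroup.zpow_mem _ hPK a)
        (Subgroup.zpow_mem _ (Subgroup.mem_sup_right (S := K.comap π) hk) b)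
      rwa [← this] at hmem
    rw [eq_top_iff]
    intro g _
    have hg : π g ∈ N ⊔ K := by rw [hK.sup_eq_top]; trivial
    rw [Subgroup.mem_sup_of_normal_left] at hg
    obtain ⟨y, hy, x, hx, hyx⟩ := hg
    obtain ⟨v, hv, rfl⟩ := hy
    have hv2 : v ∈ K.comap π ⊔ frattini Γ := by
      have : Subgroup.zpowers w ≤ K.comap π ⊔ frattini Γ := by
        rwa [Subgroup.zpowers_le]
      exact this hv
    have : v⁻¹ * g ∈ K.comap π ⊔ frattini Γ := by
      apply Subgroup.mem_sup_left
      rw [Subgroup.mem_comap, map_mul, map_inv, ← hyx, inv_mul_cancel_left]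
      exact hx
    have := Subgroup.mul_mem _ hv2 this
    rwa [mul_inv_cancel_left] at this
  have h1 := frattini_nongenerating htop
  have h2 : π w ∈ K := by
    have : w ∈ K.comap π := by rw [h1]; trivial
    exact this
  have h3 : π w ∈ N := by rw [hNz]; exact Subgroup.mem_zpowers _
  exact hπw (Subgroup.disjoint_def.1 hK.disjoint h3 h2)

/-- Theorem A: the Frattini subgroup of a finitely generated subgroup `H` of a
word-hyperbolic group `G` is finite. -/
theorem frattini_finite_of_fg_subgroup_of_hyperbolic {G : Type*} [Group G]
    (hG : IsWordHyperbolic G) (H : Subgroup G) (hH : H.FG) :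
    (frattini H : Set H).Finite := by
  classical
  obtain ⟨m⟩ := exists_hypMetric hG
  have hfg : Group.FG H := (Group.fg_iff_subgroup_fg H).2 hH
  have := coatomic_of_fg H hfg
  by_contra hinf
  obtain ⟨S, hS⟩ := hH
  by_cases hsep : m.Sep H (2 * S.toList.length + 2)
  · -- ping-pong
    have hHinf : Infinite H := by
      by_contra hfin
      rw [not_infinite_iff_finite] at hfin
      exact hinf (Set.toFinite _)
    obtain ⟨e, he⟩ := exists_ne (1 : H)
    have hFinf : ((frattini H).map H.subtype : Set G).Infinite := by
      rw [Subgroup.coe_map]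
      exact Set.Infinite.image (H.subtype_injective.injOn) hinf
    have hle : (frattini H).map H.subtype ≤ H := Subgroup.map_subtype_le _
    have hh : ∀ i, S.toList.getD i 1 ∈ H := by
      intro i
      rw [List.getD_eq_getElem?_getD]
      rcases lt_or_ge i S.toList.length with hi | hi
      · rw [List.getElem?_eq_getElem hi, Option.getD_some, ← hS]
        exact Subgroup.subset_closure (by
          exact Finset.mem_coe.2 (Finset.mem_toList.1 (List.getElem_mem hi)))
      · rw [List.getElem?_eq_none hi, Option.getD_none]
        exact H.one_mem
    obtain ⟨g, hg, hge⟩ := m.pingpong H ((frattini H).map H.subtype) hle (by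
      rintro s hs _ ⟨f, hf, rfl⟩
      exact ⟨⟨s, hs⟩ * f * ⟨s, hs⟩⁻¹, (inferInstance : (frattini H).Normal).conj_mem f hf _, rfl⟩)
      hFinf _ hsep (fun i => S.toList.getD i 1) hh (e : G) (by simpa using he)
    have hgH : ∀ i, g i ∈ H := by
      intro i
      have := H.mul_mem (hh i) (hle (hg i))
      rwa [mul_inv_cancel_left] at this
    have htop : (Subgroup.closure (Set.range g)).subgroupOf H ⊔ frattini H = ⊤ := by
      rw [eq_top_iff]
      have hmap : H ≤ ((Subgroup.closure (Set.range g)).subgroupOf H ⊔ frattini H).map H.subtype := by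
        conv_lhs => rw [← hS]
        rw [Subgroup.closure_le]
        intro x hx
        have hx' : x ∈ S.toList := by simpa using hx
        obtain ⟨i, hi, rfl⟩ := List.getElem_of_mem hx'
        have e1 : S.toList.getD i 1 = S.toList[i] := by
          rw [List.getD_eq_getElem?_getD, List.getElem?_eq_getElem hi, Option.getD_some]
        have h1 := hg ⟨i, hi⟩
        simp only [e1] at h1
        have h2 : g ⟨i, hi⟩ ∈
            ((Subgroup.closure (Set.range g)).subgroupOf H ⊔ frattini H).map H.subtype :=
          ⟨⟨g ⟨i, hi⟩, hgH _⟩, Subgroup.mem_sup_left (by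
            rw [Subgroup.mem_subgroupOf]
            exact Subgroup.subset_closure ⟨_, rfl⟩), rfl⟩
        have h3 := Subgroup.map_mono (f := H.subtype)
          (le_sup_right (a := (Subgroup.closure (Set.range g)).subgroupOf H)) h1
        have h4 := Subgroup.mul_mem _ h2 (Subgroup.inv_mem _ h3)
        simpa using h4
      rintro ⟨x, hx⟩ _
      obtain ⟨y, hy, hyx⟩ := hmap hx
      have : y = ⟨x, hx⟩ := Subtype.ext hyx
      rwa [← this]
    have h1 := frattini_nongenerating htop
    have h2 : e ∈ (Subgroup.closure (Set.range g)).subgroupOf H := by rw [h1]; trivial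
    exact hge (Subgroup.mem_subgroupOf.1 h2)
  · -- linear growth
    obtain ⟨M, hM⟩ := m.not_sep_lin H _ hsep
    by_cases hf : ∀ t ∈ H, IsOfFinOrder t
    · have := m.not_sep_fin H _ hsep hf
      have : Finite H := this
      exact hinf (Set.toFinite _)
    · push Not at hf
      obtain ⟨t, htH, ht⟩ := hf
      have hz : ¬ IsOfFinOrder (⟨t, htH⟩ : H) := by
        rwa [← Submonoid.isOfFinOrder_coe]
      exact hinf (frattini_finite_of_vcyclic _ hz (m.finiteIndex_zpowers H M hM _ hz))
end

section
/- Let G be a word-hyperbolic group and let H be a finitely generated subgroup of G. Then every element of the Frattini subgroup F(H) of H has finite order; that is, F(H) is a torsion group. -/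
structure HypLen {G : Type*} [Group G] (ℓ : G → ℝ) (δ : ℝ) : Prop where
  one : ℓ 1 = 0
  inv : ∀ g, ℓ g⁻¹ = ℓ g
  mul : ∀ g h, ℓ (g * h) ≤ ℓ g + ℓ h
  fin : ∀ R : ℝ, {g | ℓ g ≤ R}.Finite
  dpos : 0 ≤ δ
  hyp : ∀ x y z w : G, ℓ (x⁻¹ * y) + ℓ (z⁻¹ * w) ≤
    max (ℓ (x⁻¹ * z) + ℓ (y⁻¹ * w)) (ℓ (x⁻¹ * w) + ℓ (y⁻¹ * z)) + 2 * δ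

namespace HypLen

variable {G : Type*} [Group G] {ℓ : G → ℝ} {δ : ℝ}

lemma nonneg (L : HypLen ℓ δ) (g : G) : 0 ≤ ℓ g := by
  have h := L.mul g g⁻¹
  rw [mul_inv_cancel, L.one, L.inv] at h
  linarith

lemma symm (L : HypLen ℓ δ) (x y : G) : ℓ (x⁻¹ * y) = ℓ (y⁻¹ * x) := by
  rw [← L.inv]; simp

lemma tri (L : HypLen ℓ δ) (x y z : G) : ℓ (x⁻¹ * z) ≤ ℓ (x⁻¹ * y) + ℓ (y⁻¹ * z) := by
  have h := L.mul (x⁻¹ * y) (y⁻¹ * z)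
  rwa [show x⁻¹ * y * (y⁻¹ * z) = x⁻¹ * z by group] at h

lemma exists_large (L : HypLen ℓ δ) (h : G) (hh : ¬ IsOfFinOrder h) (R : ℝ) :
    ∃ N : ℕ, R < ℓ (h ^ N) := by
  by_contra! hc
  have hinj := injective_pow_iff_not_isOfFinOrder.2 hh
  exact Set.infinite_range_of_injective hinj
    ((L.fin R).subset (by rintro _ ⟨n, rfl⟩; exact hc n))

/-- No parabolic elements. -/
lemma no_parabolic (L : HypLen ℓ δ)
    (mid : ∀ g, ∃ p, ℓ p ≤ ℓ g / 2 + 1 / 2 ∧ ℓ (p⁻¹ * g) ≤ ℓ g / 2 + 1 / 2)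
    (h : G) (hh : ¬ IsOfFinOrder h) (c : ℝ) :
    ∃ (i : ℕ) (x : G), 1 ≤ i ∧ ℓ (x⁻¹ * (h ^ i * x)) + c < ℓ (x⁻¹ * (h ^ i * (h ^ i * x))) := by
  by_contra! hc
  have hδ := L.dpos
  have hinj := injective_pow_iff_not_isOfFinOrder.2 hh
  set K := c + 2 + 6 * δ with hK
  obtain ⟨A, hA⟩ : ∃ A : ℝ, ∀ i ∈ Finset.Icc 1 ((L.fin K).toFinset.card + 1), ℓ (h ^ i) ≤ A := by
    obtain ⟨A, hA⟩ := ((Finset.Icc 1 ((L.fin K).toFinset.card + 1)).image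
      (fun i => ℓ (h ^ i))).bddAbove
    exact ⟨A, fun i hi => hA (by simpa using ⟨i, by simpa using hi, rfl⟩)⟩
  have hA0 : 0 ≤ A := (L.nonneg _).trans (hA 1 (by simp))
  obtain ⟨N, hN⟩ := L.exists_large h hh (4 * A + 4 + 3 * (1 + 2 * δ) + 2 * δ)
  obtain ⟨p, hp1, hp2⟩ := mid (h ^ N)
  set b := h ^ N with hb
  have key : ∀ i ∈ Finset.Icc 1 ((L.fin K).toFinset.card + 1), ℓ (p⁻¹ * (h ^ i * p)) ≤ K := by
    intro i hi
    have hAi := hA i hi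
    have hpar := hc i p (by simp at hi; omega)
    set q := h ^ i * p with hq
    set r := h ^ i * q with hr
    have hbb : b * h ^ i = h ^ i * b := (Commute.refl h).pow_pow _ _
    -- translates
    have e1 : ℓ ((h ^ i)⁻¹ * q) = ℓ p := by rw [hq]; simp
    have e2 : ℓ ((h ^ i * b)⁻¹ * q) = ℓ (b⁻¹ * p) := by rw [hq]; congr 1; group
    have e3 : ℓ (q⁻¹ * r) = ℓ (p⁻¹ * q) := by rw [hr, hq]; congr 1; group
    have e4 : ℓ ((h ^ i * b)⁻¹ * r) = ℓ (b⁻¹ * q) := by rw [hr]; congr 1; group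
    have e5 : ℓ ((h ^ i)⁻¹ * r) = ℓ q := by rw [hr]; simp
    have e6 : ℓ (b⁻¹ * (h ^ i * b)) = ℓ (h ^ i) := by rw [← hbb]; simp
    have s1 := L.symm p b
    have f1 := L.hyp 1 b p q
    have t1 := L.tri 1 (h ^ i) q
    have t2 := L.tri b (h ^ i * b) q
    have t3 := L.tri b q p
    have t4 := L.tri 1 q p
    have t5 := L.tri 1 p b
    have t6 := L.tri b p r
    have t7 := L.tri 1 p r
    have s2 := L.symm p q
    have f2 := L.hyp b q (h ^ i * b) r
    have f3 := L.hyp 1 q (h ^ i) r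
    have s3 := L.symm q (h ^ i * b)
    have s4 := L.symm q (h ^ i)
    simp only [inv_one, one_mul] at f1 t1 t4 t5 t7 f3
    rcases max_cases (ℓ p + ℓ (b⁻¹ * q)) (ℓ q + ℓ (b⁻¹ * p)) with ⟨m1, m1'⟩ | ⟨m1, m1'⟩
    · rcases max_cases (ℓ (b⁻¹ * (h ^ i * b)) + ℓ (q⁻¹ * r))
        (ℓ (b⁻¹ * r) + ℓ (q⁻¹ * (h ^ i * b))) with ⟨m2, m2'⟩ | ⟨m2, m2'⟩
      · linarith
      · linarith
    · rcases max_cases (ℓ (h ^ i) + ℓ (q⁻¹ * r))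
        (ℓ r + ℓ (q⁻¹ * (h ^ i))) with ⟨m2, m2'⟩ | ⟨m2, m2'⟩
      · linarith
      · linarith
  have hcard := Finset.card_le_card_of_injOn (s := Finset.Icc 1 ((L.fin K).toFinset.card + 1))
    (t := (L.fin K).toFinset) (fun i => p⁻¹ * (h ^ i * p))
    (fun i hi => by simpa using key i hi)
    (fun i _ j _ hij => hinj (by simpa using hij))
  simp at hcard

/-- `z` is good: word lengths of powers increase by definite steps. -/
def Good (ℓ : G → ℝ) (δ : ℝ) (z : G) : Prop := ∀ n : ℕ, ℓ (z ^ n) + (2 * δ + 1) ≤ ℓ (z ^ (n + 1))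

lemma exists_good (L : HypLen ℓ δ)
    (mid : ∀ g, ∃ p, ℓ p ≤ ℓ g / 2 + 1 / 2 ∧ ℓ (p⁻¹ * g) ≤ ℓ g / 2 + 1 / 2)
    (h : G) (hh : ¬ IsOfFinOrder h) : ∃ k : ℕ, 1 ≤ k ∧ Good ℓ δ (h ^ k) := by
  have hδ := L.dpos
  obtain ⟨i, x, hi, hx⟩ := L.no_parabolic mid h hh (2 * δ + 1)
  set g := h ^ i with hg
  have step : ∀ n : ℕ, ℓ (x⁻¹ * (g ^ n * x)) + 1 ≤ ℓ (x⁻¹ * (g ^ (n + 1) * x)) := by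
    intro n
    induction n with
    | zero =>
      have h1 := L.tri (g * (g * x)) (g * x) x
      have h2 := L.symm x (g * (g * x))
      have h3 : ℓ ((g * (g * x))⁻¹ * (g * x)) = ℓ (x⁻¹ * (g * x)) := by
        rw [L.symm]; congr 1; group
      have h4 := L.symm (g * x) x
      simp [L.one]
      linarith
    | succ n ih =>
      have f := L.hyp x (g * (g * x)) (g * x) (g ^ (n + 2) * x)
      have e1 : ℓ ((g * x)⁻¹ * (g ^ (n + 2) * x)) = ℓ (x⁻¹ * (g ^ (n + 1) * x)) := by
        congr 1; rw [pow_succ' g (n + 1)]; group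
      have e2 : ℓ ((g * (g * x))⁻¹ * (g ^ (n + 2) * x)) = ℓ (x⁻¹ * (g ^ n * x)) := by
        congr 1; rw [pow_succ' g (n + 1), pow_succ' g n]; group
      have e3 : ℓ ((g * (g * x))⁻¹ * (g * x)) = ℓ (x⁻¹ * (g * x)) := by
        rw [L.symm]; congr 1; group
      rw [e1, e2, e3] at f
      rcases max_cases (ℓ (x⁻¹ * (g * x)) + ℓ (x⁻¹ * (g ^ n * x)))
        (ℓ (x⁻¹ * (g ^ (n + 2) * x)) + ℓ (x⁻¹ * (g * x))) with ⟨m2, m2'⟩ | ⟨m2, m2'⟩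
      · linarith
      · show _ ≤ ℓ (x⁻¹ * (g ^ (n + 2) * x))
        linarith
  have steps : ∀ k n : ℕ, ℓ (x⁻¹ * (g ^ n * x)) + k ≤ ℓ (x⁻¹ * (g ^ (n + k) * x)) := by
    intro k
    induction k with
    | zero => intro n; simp
    | succ k ih =>
      intro n
      have := step (n + k)
      have := ih n
      push_cast
      rw [show n + (k + 1) = n + k + 1 from rfl]
      linarith
  obtain ⟨k, hk⟩ := exists_nat_gt (4 * ℓ x + 2 * δ + 1)
  have hx0 := L.nonneg x
  have hk1 : 1 ≤ k := by
    rcases Nat.eq_zero_or_pos k with rfl | h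
    · simp at hk; linarith
    · exact h
  refine ⟨i * k, Nat.mul_pos hi hk1, fun n => ?_⟩
  have hs := steps k (k * n)
  have up : ∀ m : ℕ, ℓ (x⁻¹ * (g ^ m * x)) ≤ ℓ (g ^ m) + 2 * ℓ x := by
    intro m
    have h1 := L.mul x⁻¹ (g ^ m * x)
    have h2 := L.mul (g ^ m) x
    rw [L.inv] at h1
    linarith
  have dn : ∀ m : ℕ, ℓ (g ^ m) ≤ ℓ (x⁻¹ * (g ^ m * x)) + 2 * ℓ x := by
    intro m
    have h1 := L.mul x (x⁻¹ * (g ^ m * x))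
    have h2 := L.mul (x * (x⁻¹ * (g ^ m * x))) x⁻¹
    rw [show x * (x⁻¹ * (g ^ m * x)) * x⁻¹ = g ^ m by group, L.inv] at h2
    linarith
  have h1 := up (k * n + k)
  have h2 := dn (k * n)
  rw [show (h ^ (i * k)) ^ n = g ^ (k * n) by rw [hg, ← pow_mul, ← pow_mul, mul_assoc],
    show (h ^ (i * k)) ^ (n + 1) = g ^ (k * n + k) by
      rw [hg, ← pow_mul, ← pow_mul, mul_assoc, mul_add, mul_one]]
  linarith

section good

variable {z : G}

lemma Good.add_le (_L : HypLen ℓ δ) (hz : Good ℓ δ z) (n k : ℕ) :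
    ℓ (z ^ n) + k * (2 * δ + 1) ≤ ℓ (z ^ (n + k)) := by
  induction k with
  | zero => simp
  | succ k ih =>
    have := hz (n + k)
    push_cast
    rw [← add_assoc]
    linarith

lemma Good.add_le' (L : HypLen ℓ δ) (hz : Good ℓ δ z) (n k : ℕ) :
    ℓ (z ^ n) + k ≤ ℓ (z ^ (n + k)) := by
  have h := hz.add_le L n k
  have : 0 ≤ (k : ℝ) * δ := mul_nonneg k.cast_nonneg L.dpos
  nlinarith

lemma Good.le (L : HypLen ℓ δ) (hz : Good ℓ δ z) (n : ℕ) : (n : ℝ) ≤ ℓ (z ^ n) := by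
  have := hz.add_le' L 0 n
  simpa [L.one] using this

lemma Good.mono (L : HypLen ℓ δ) (hz : Good ℓ δ z) {n m : ℕ} (h : n ≤ m) :
    ℓ (z ^ n) ≤ ℓ (z ^ m) := by
  obtain ⟨k, rfl⟩ := Nat.exists_eq_add_of_le h
  have := hz.add_le' L n k
  have : (0 : ℝ) ≤ k := k.cast_nonneg
  linarith

lemma Good.le_of_le (L : HypLen ℓ δ) (hz : Good ℓ δ z) {n m : ℕ}
    (h : ℓ (z ^ n) ≤ ℓ (z ^ m)) : n ≤ m := by
  by_contra! hc
  have h1 := hz m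
  have h2 := hz.mono L (show m + 1 ≤ n from hc)
  have := L.dpos
  linarith

lemma Good.inv (L : HypLen ℓ δ) (hz : Good ℓ δ z) : Good ℓ δ z⁻¹ := by
  intro n
  simpa [inv_pow, L.inv] using hz n

lemma Good.pow (L : HypLen ℓ δ) (hz : Good ℓ δ z) {p : ℕ} (hp : 1 ≤ p) : Good ℓ δ (z ^ p) := by
  intro n
  rw [← pow_mul, ← pow_mul]
  have h1 := hz (p * n)
  have h2 := hz.mono L (show p * n + 1 ≤ p * (n + 1) by rw [mul_add]; omega)
  linarith

/-- Quasi-additivity of the length along powers of a good element. -/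
lemma Good.qadd (L : HypLen ℓ δ) (hz : Good ℓ δ z) (k m : ℕ) :
    ℓ (z ^ k) + ℓ (z ^ m) ≤ ℓ (z ^ (k + m)) + ℓ z + 2 * δ := by
  have hδ := L.dpos
  cases m with
  | zero =>
    have := L.nonneg z
    simp [L.one]; linarith
  | succ m =>
    have f := L.hyp 1 (z ^ (k + 1)) (z ^ k) (z ^ (k + (m + 1)))
    have e1 : (z ^ k)⁻¹ * z ^ (k + (m + 1)) = z ^ (m + 1) := by rw [pow_add]; group
    have e2 : (z ^ (k + 1))⁻¹ * z ^ (k + (m + 1)) = z ^ m := by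
      rw [show k + (m + 1) = (k + 1) + m by ring, pow_add z (k + 1)]; group
    have e3 : ℓ ((z ^ (k + 1))⁻¹ * z ^ k) = ℓ z := by
      rw [L.symm, pow_succ]; congr 1; group
    rw [e1, e2, e3] at f
    simp only [inv_one, one_mul] at f
    have h1 := hz k
    have h2 := hz m
    rcases max_cases (ℓ (z ^ k) + ℓ (z ^ m)) (ℓ (z ^ (k + (m + 1))) + ℓ z) with ⟨a, b⟩ | ⟨a, b⟩
    · linarith
    · linarith

/-- Gromov product based at `1`. -/
noncomputable def gp (ℓ : G → ℝ) (x y : G) : ℝ := (ℓ x + ℓ y - ℓ (x⁻¹ * y)) / 2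

lemma gp_symm (L : HypLen ℓ δ) (x y : G) : gp ℓ x y = gp ℓ y x := by
  unfold gp; rw [L.symm x y]; ring

lemma gp_le_right (L : HypLen ℓ δ) (x y : G) : gp ℓ x y ≤ ℓ y := by
  unfold gp
  have := L.tri 1 y x
  have := L.symm x y
  simp only [inv_one, one_mul] at *
  linarith

lemma gp_le_left (L : HypLen ℓ δ) (x y : G) : gp ℓ x y ≤ ℓ x := by
  rw [L.gp_symm]; exact L.gp_le_right y x

lemma gp_hyp (L : HypLen ℓ δ) (x y w : G) : min (gp ℓ x y) (gp ℓ y w) ≤ gp ℓ x w + δ := by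
  have f := L.hyp 1 y x w
  have := L.symm x y
  simp only [inv_one, one_mul] at f
  unfold gp
  rcases max_cases (ℓ x + ℓ (y⁻¹ * w)) (ℓ w + ℓ (y⁻¹ * x)) with ⟨a, b⟩ | ⟨a, b⟩
  · exact (min_le_right _ _).trans (by linarith)
  · exact (min_le_left _ _).trans (by linarith)

/-- Fellow travelling. -/
lemma Good.fellow (L : HypLen ℓ δ) (hz : Good ℓ δ z) (u : G) (m n i : ℕ)
    (hT : ℓ (z ^ i) ≤ gp ℓ (z ^ m) (u * z ^ n)) (hi : ℓ u + ℓ z + 4 * δ < ℓ (z ^ i)) :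
    ∃ j : ℕ, ℓ ((z ^ i)⁻¹ * (u * z ^ j)) ≤ 2 * ℓ z + 6 * δ := by
  classical
  have hδ := L.dpos
  have hz0 := L.nonneg z
  have hex : ∃ j, ℓ (z ^ i) ≤ ℓ (u * z ^ j) := ⟨n, hT.trans (L.gp_le_right _ _)⟩
  obtain ⟨j, hj, hjm⟩ : ∃ j, ℓ (z ^ i) ≤ ℓ (u * z ^ j) ∧
      ∀ k < j, ¬ ℓ (z ^ i) ≤ ℓ (u * z ^ k) := ⟨Nat.find hex, Nat.find_spec hex,
        fun k hk => Nat.find_min hex hk⟩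
  have hjn : j ≤ n := by
    by_contra! hc
    exact hjm n hc (hT.trans (L.gp_le_right _ _))
  have hj2 : ℓ (u * z ^ j) ≤ ℓ (z ^ i) + ℓ z := by
    cases j with
    | zero => simp at hj; linarith
    | succ j =>
      have h1 := hjm j (by omega)
      have h2 := L.mul (u * z ^ j) z
      rw [mul_assoc, ← pow_succ] at h2
      linarith
  have him : i ≤ m := hz.le_of_le L (hT.trans (L.gp_le_left _ _))
  refine ⟨j, ?_⟩
  obtain ⟨k, rfl⟩ := Nat.exists_eq_add_of_le hjn
  obtain ⟨r, rfl⟩ := Nat.exists_eq_add_of_le him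
  have q1 := hz.qadd L j k
  have q2 := hz.qadd L i r
  have f := L.hyp (u * z ^ j) 1 u (u * z ^ (j + k))
  have e1 : ℓ ((u * z ^ j)⁻¹ * 1) = ℓ (u * z ^ j) := by rw [mul_one, L.inv]
  have e2 : ℓ (u⁻¹ * (u * z ^ (j + k))) = ℓ (z ^ (j + k)) := by simp
  have e3 : ℓ ((u * z ^ j)⁻¹ * u) = ℓ (z ^ j) := by rw [L.symm]; simp
  have e4 : ℓ ((u * z ^ j)⁻¹ * (u * z ^ (j + k))) = ℓ (z ^ k) := by
    rw [pow_add]; congr 1; group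
  have e5 : ℓ ((z ^ i)⁻¹ * z ^ (i + r)) = ℓ (z ^ r) := by rw [pow_add]; simp
  rw [e1, e2, e3, e4] at f
  simp only [inv_one, one_mul] at f
  have hY : gp ℓ (u * z ^ (j + k)) (u * z ^ j) ≥ ℓ (u * z ^ j) - (ℓ z + 4 * δ) / 2 := by
    rw [L.gp_symm]
    unfold gp
    rw [e4]
    have := L.nonneg (z ^ j)
    rcases max_cases (ℓ (z ^ j) + ℓ (u * z ^ (j + k))) (ℓ (z ^ k) + ℓ u) with ⟨a, b⟩ | ⟨a, b⟩
    · linarith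
    · linarith
  have hX : gp ℓ (z ^ i) (z ^ (i + r)) ≥ ℓ (z ^ i) - (ℓ z + 2 * δ) / 2 := by
    unfold gp
    rw [e5]
    linarith
  have g1 := L.gp_hyp (z ^ i) (z ^ (i + r)) (u * z ^ (j + k))
  have g2 := L.gp_hyp (z ^ i) (u * z ^ (j + k)) (u * z ^ j)
  have g1' : ℓ (z ^ i) - (ℓ z + 2 * δ) / 2 - δ ≤ gp ℓ (z ^ i) (u * z ^ (j + k)) := by
    have : ℓ (z ^ i) - (ℓ z + 2 * δ) / 2 ≤
      min (gp ℓ (z ^ i) (z ^ (i + r))) (gp ℓ (z ^ (i + r)) (u * z ^ (j + k))) :=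
      le_min hX (by linarith)
    linarith
  have g2' : ℓ (z ^ i) - (ℓ z + 4 * δ) / 2 - δ ≤ gp ℓ (z ^ i) (u * z ^ j) := by
    have : ℓ (z ^ i) - (ℓ z + 4 * δ) / 2 ≤
      min (gp ℓ (z ^ i) (u * z ^ (j + k))) (gp ℓ (u * z ^ (j + k)) (u * z ^ j)) :=
      le_min (by linarith) (by linarith)
    linarith
  unfold gp at g2'
  linarith

end good
end HypLen

namespace HypLen
variable {G : Type*} [Group G] {ℓ : G → ℝ} {δ : ℝ} {z : G}

/-- If `u z^q u⁻¹ = z^p` for a good `z` then `|q| = p`. -/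
lemma Good.natAbs_eq (L : HypLen ℓ δ) (hz : Good ℓ δ z) (u : G) (p : ℕ) (q : ℤ)
    (h : u * z ^ q * u⁻¹ = z ^ p) : q.natAbs = p := by
  have hk : ∀ k : ℕ, |ℓ (z ^ (q.natAbs * k)) - ℓ (z ^ (p * k))| ≤ 2 * ℓ u := by
    intro k
    have e : u * z ^ (q * k) * u⁻¹ = z ^ (p * k) := by
      rw [pow_mul, ← h, conj_pow, zpow_mul, zpow_natCast]
    have e2 : ℓ (z ^ (q * k)) = ℓ (z ^ (q.natAbs * k)) := by
      rcases Int.natAbs_eq q with hq | hq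
      · conv_lhs => rw [hq, ← Nat.cast_mul, zpow_natCast]
      · conv_lhs => rw [hq, neg_mul, ← Nat.cast_mul, zpow_neg, zpow_natCast, L.inv]
    rw [← e2, ← e]
    have h1 := L.mul (u * z ^ (q * k)) u⁻¹
    have h2 := L.mul u (z ^ (q * k))
    have h3 := L.mul (u⁻¹ * (u * z ^ (q * k) * u⁻¹)) u
    have h4 := L.mul u⁻¹ (u * z ^ (q * k) * u⁻¹)
    rw [show u⁻¹ * (u * z ^ (q * k) * u⁻¹) * u = z ^ (q * k) by group] at h3
    rw [L.inv] at h1 h4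
    rw [abs_le]
    constructor <;> linarith
  obtain ⟨k, hk2⟩ := exists_nat_gt (2 * ℓ u)
  have hkk := abs_le.1 (hk k)
  have aux : ∀ a b : ℕ, a < b → ℓ (z ^ (a * k)) + k ≤ ℓ (z ^ (b * k)) := by
    intro a b hab
    have h1 := hz.add_le' L (a * k) k
    have h2 := hz.mono L (show a * k + k ≤ b * k by nlinarith)
    linarith
  rcases lt_trichotomy q.natAbs p with h1 | h1 | h1
  · have := aux _ _ h1; linarith
  · exact h1
  · have := aux _ _ h1; linarith

/-- The universal exponent attached to a good element. -/
noncomputable def expo (ℓ : G → ℝ) (δ : ℝ) (z : G) : ℕ :=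
  ({g | ℓ g ≤ 2 * ℓ z + 6 * δ}.ncard).factorial

lemma expo_inv (L : HypLen ℓ δ) : expo ℓ δ z⁻¹ = expo ℓ δ z := by
  unfold expo; rw [L.inv]

lemma Good.commute (L : HypLen ℓ δ) (hz : Good ℓ δ z) (u : G)
    (hu : ∀ T : ℝ, ∃ m n : ℕ, T ≤ gp ℓ (z ^ m) (u * z ^ n)) :
    Commute u (z ^ expo ℓ δ z) := by
  classical
  set B := {g | ℓ g ≤ 2 * ℓ z + 6 * δ} with hB
  have hBf : B.Finite := L.fin _
  set M := B.ncard with hM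
  have hδ := L.dpos
  obtain ⟨i0, hi0⟩ := exists_nat_gt (ℓ u + ℓ z + 4 * δ + (2 * ℓ z + 6 * δ) + ℓ u + ℓ (z ^ M))
  have hz0 := L.nonneg z
  have hu0 := L.nonneg u
  have hM0 := L.nonneg (z ^ M)
  have hlarge : ∀ i, i0 ≤ i →
      ℓ u + ℓ z + 4 * δ + (2 * ℓ z + 6 * δ) + ℓ u + ℓ (z ^ M) < ℓ (z ^ i) := by
    intro i hi
    have h1 := hz.le L i0
    have h2 := hz.mono L hi
    linarith
  have hj : ∀ i, i0 ≤ i → ∃ j : ℕ, (z ^ i)⁻¹ * (u * z ^ j) ∈ B := by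
    intro i hi
    obtain ⟨m, n, hmn⟩ := hu (ℓ (z ^ i))
    have := hlarge i hi
    exact hz.fellow L u m n i hmn (by linarith)
  choose! j hj using hj
  obtain ⟨i1, h1, i2, h2, hne, heq⟩ : ∃ i1 ∈ Finset.Icc i0 (i0 + M), ∃ i2 ∈ Finset.Icc i0 (i0 + M),
      i1 ≠ i2 ∧ (z ^ i1)⁻¹ * (u * z ^ j i1) = (z ^ i2)⁻¹ * (u * z ^ j i2) := by
    refine Finset.exists_ne_map_eq_of_card_lt_of_maps_to (t := hBf.toFinset) ?_ ?_
    · rw [← Set.ncard_eq_toFinset_card B hBf]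
      simp only [Nat.card_Icc]; omega
    · intro i hi
      have hi' : i ∈ Finset.Icc i0 (i0 + M) := by simpa using hi
      simpa using hj i (Finset.mem_Icc.1 hi').1
  wlog hlt : i1 < i2 generalizing i1 i2
  · exact this i2 h2 i1 h1 hne.symm heq.symm (by omega)
  rw [Finset.mem_Icc] at h1 h2
  obtain ⟨p, rfl⟩ := Nat.exists_eq_add_of_lt hlt
  set P := p + 1 with hP
  have hPM : P ≤ M := by omega
  have e : u * z ^ ((j (i1 + p + 1) : ℤ) - j i1) * u⁻¹ = z ^ P := by
    rw [zpow_sub, zpow_natCast, zpow_natCast]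
    have h3 : z ^ (i1 + p + 1) = z ^ P * z ^ i1 := by rw [← pow_add]; congr 1; omega
    rw [h3] at heq
    have h4 : u * z ^ j (i1 + p + 1) = z ^ P * (u * z ^ j i1) := by
      have : u * z ^ j (i1 + p + 1) =
        (z ^ P * z ^ i1) * ((z ^ P * z ^ i1)⁻¹ * (u * z ^ j (i1 + p + 1))) := by group
      rw [this, ← heq]
      simp only [mul_assoc, mul_inv_cancel_left]
    rw [← mul_assoc, h4]
    group
  have habs := hz.natAbs_eq L u P _ e
  have hcomm : Commute u (z ^ P) := by
    rcases Int.natAbs_eq ((j (i1 + p + 1) : ℤ) - j i1) with hq | hq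
    · rw [hq, habs, zpow_natCast] at e
      exact mul_inv_eq_iff_eq_mul.1 e
    · exfalso
      rw [hq, habs, zpow_neg, zpow_natCast] at e
      have e' : u * z ^ P = (z ^ P)⁻¹ * u := by
        have : u * z ^ P * u⁻¹ = (z ^ P)⁻¹ := by
          calc u * z ^ P * u⁻¹ = (u * (z ^ P)⁻¹ * u⁻¹)⁻¹ := by group
            _ = (z ^ P)⁻¹ := by rw [e]
        exact mul_inv_eq_iff_eq_mul.1 this
      have ek : ∀ k : ℕ, u * z ^ (P * k) = (z ^ (P * k))⁻¹ * u := by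
        intro k
        induction k with
        | zero => simp
        | succ k ih =>
          have : z ^ (P * (k + 1)) = z ^ P * z ^ (P * k) := by rw [← pow_add]; congr 1; ring
          rw [this, ← mul_assoc, e', mul_assoc, ih, ← mul_assoc, mul_inv_rev]
          congr 1
          rw [← mul_inv_rev, ← mul_inv_rev, ← pow_add, ← pow_add, add_comm]
      have hb := hj i1 h1.1
      set J := j i1
      have hJ : z ^ J = z ^ (P * (J / P)) * z ^ (J % P) := by
        rw [← pow_add, Nat.div_add_mod]
      rw [hJ, ← mul_assoc u, ek] at hb
      have hb' : ℓ ((z ^ (i1 + P * (J / P)))⁻¹ * (u * z ^ (J % P))) ≤ 2 * ℓ z + 6 * δ := by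
        have : (z ^ (i1 + P * (J / P)))⁻¹ * (u * z ^ (J % P)) =
          (z ^ i1)⁻¹ * ((z ^ (P * (J / P)))⁻¹ * u * z ^ (J % P)) := by
          rw [add_comm, pow_add]; group
        rw [this]; exact hb
      have t := L.tri 1 (u * z ^ (J % P)) (z ^ (i1 + P * (J / P)))
      rw [L.symm (u * z ^ (J % P))] at t
      simp only [inv_one, one_mul] at t
      have t2 := L.mul u (z ^ (J % P))
      have t3 := hz.mono L (show J % P ≤ M from (Nat.mod_lt _ (by omega)).le.trans hPM)
      have t4 := hz.mono L (show i1 ≤ i1 + P * (J / P) by omega)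
      have t5 := hlarge i1 h1.1
      linarith
  obtain ⟨c, hc⟩ : P ∣ expo ℓ δ z := Nat.dvd_factorial (by omega) hPM
  rw [hc, pow_mul]
  exact hcomm.pow_right c

/-- The centralizer of a good element is virtually cyclic. -/
lemma Good.near (L : HypLen ℓ δ) (hz : Good ℓ δ z) (u : G) (hu : Commute u z) :
    ∃ k : ℤ, ℓ (u * z ^ k) ≤ 2 * ℓ z + 6 * δ := by
  have hδ := L.dpos
  obtain ⟨i, hi⟩ := exists_nat_gt (ℓ u + ℓ z + 4 * δ)
  obtain ⟨m, hm⟩ := exists_nat_gt (ℓ (z ^ i) + ℓ u)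
  have h1 := hz.le L i
  have h2 := hz.le L m
  obtain ⟨j, hj⟩ := hz.fellow L u m m i (by
    have e : (z ^ m)⁻¹ * (u * z ^ m) = u := by rw [(hu.pow_right m).eq]; simp
    unfold gp
    rw [e]
    have := L.mul u⁻¹ (u * z ^ m)
    rw [inv_mul_cancel_left, L.inv] at this
    linarith) (by linarith)
  refine ⟨j - i, ?_⟩
  convert hj using 2
  rw [sub_eq_neg_add, zpow_add, zpow_neg, zpow_natCast, zpow_natCast, ← mul_assoc,
    (hu.pow_right i).inv_right.eq, mul_assoc]

end HypLen

namespace HypLen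
variable {G : Type*} [Group G] {ℓ : G → ℝ} {δ : ℝ} {z : G}

/-- Ping-pong estimate for reduced words. -/
lemma pingpong (L : HypLen ℓ δ) {ι : Type*} (W : ι × Bool → G)
    (hinv : ∀ i b, W (i, !b) = (W (i, b))⁻¹) (B R : ℝ) (hB : 0 ≤ B)
    (hgp : ∀ l l', l ≠ l' → gp ℓ (W l) (W l') ≤ B)
    (hR : 0 ≤ R) (hlen : ∀ l, R + 2 * B + 2 * δ + 1 ≤ ℓ (W l))
    (w : List (ι × Bool)) : ∀ l, FreeGroup.IsReduced (l :: w) →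
      R ≤ ℓ ((l :: w).map W).prod ∧ B + δ < gp ℓ ((l :: w).map W).prod (W l) := by
  have hδ := L.dpos
  induction w with
  | nil =>
    intro l _
    have := hlen l
    simp only [List.map_cons, List.map_nil, List.prod_cons, List.prod_nil, mul_one, gp,
      inv_mul_cancel, L.one]
    constructor <;> linarith
  | cons l2 w ih =>
    intro l hl
    rw [FreeGroup.isReduced_cons_cons] at hl
    obtain ⟨ih1, ih2⟩ := ih l2 hl.2
    rw [List.map_cons, List.prod_cons]
    set g := ((l2 :: w).map W).prod
    have hne : (l.1, !l.2) ≠ l2 := by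
      rintro rfl
      have := hl.1 rfl
      simp at this
    have h1 := hgp _ _ hne
    rw [hinv] at h1
    have h2 := L.gp_hyp (W l)⁻¹ g (W l2)
    have h3 : gp ℓ (W l)⁻¹ g ≤ B + δ := by
      by_contra! hc
      have : B + δ < min (gp ℓ (W l)⁻¹ g) (gp ℓ g (W l2)) := lt_min hc ih2
      have h1' : gp ℓ (W l)⁻¹ (W l2) ≤ B := h1
      linarith
    have h4 := hlen l
    unfold gp at h3
    rw [inv_inv, L.inv] at h3
    have h5 : ℓ ((W l * g)⁻¹ * W l) = ℓ g := by rw [L.symm]; simp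
    have hg0 := L.nonneg g
    refine ⟨by linarith, ?_⟩
    unfold gp
    rw [h5]
    linarith

/-- In the non-elementary case, multiply generators by elements of `F`. -/
lemma nonelementary (L : HypLen ℓ δ) (F : Subgroup G) [F.Normal] (hzF : z ∈ F)
    (hz : Good ℓ δ z)
    (hp : ∀ u, ¬ Commute u z → ∃ T : ℝ, ∀ n : ℕ, gp ℓ (z ^ n) (u * z ^ n) ≤ T)
    (hm : ∀ u, ¬ Commute u z → ∃ T : ℝ, ∀ n : ℕ, gp ℓ (z⁻¹ ^ n) (u * z⁻¹ ^ n) ≤ T)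
    (hinf : Infinite (G ⧸ Subgroup.centralizer {z}))
    {ι : Type*} [Finite ι] (x : ι → G) (hx : Subgroup.closure (Set.range x) = ⊤) :
    ∃ K : Subgroup G, K ≠ ⊤ ∧ K ⊔ F = ⊤ := by
  classical
  have hδ := L.dpos
  set C := Subgroup.centralizer {z} with hC
  have hCm : ∀ u v : G, (u : G ⧸ C) ≠ v → ¬ Commute (u⁻¹ * v) z := by
    intro u v huv hc
    apply huv
    rw [QuotientGroup.eq, hC, Subgroup.mem_centralizer_singleton_iff]
    exact hc.eq
  obtain ⟨n, ⟨en⟩⟩ := Finite.exists_equiv_fin ι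
  -- choose the `k i`
  have hk : ∃ k : ι → G, Function.Injective (fun i => (k i : G ⧸ C)) := by
    let f := Infinite.natEmbedding (G ⧸ C)
    refine ⟨fun i => (f (en i)).out, fun i j hij => ?_⟩
    simp only [QuotientGroup.out_eq'] at hij
    exact en.injective (Fin.val_injective (f.injective hij))
  obtain ⟨k, hkinj⟩ := hk
  let A : Set (G ⧸ C) := Set.range (fun i => (k i : G ⧸ C)) ∪ Set.range (fun i => ((x i * k i : G) : G ⧸ C))
  have hA : A.Finite := (Set.finite_range _).union (Set.finite_range _)
  have hg : ∃ g : ι → G, Function.Injective (fun i => (g i : G ⧸ C)) ∧ ∀ i, (g i : G ⧸ C) ∉ A := by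
    let f := hA.infinite_compl.natEmbedding
    refine ⟨fun i => (f (en i)).1.out, fun i j hij => ?_, fun i => ?_⟩
    · simp only [QuotientGroup.out_eq'] at hij
      exact en.injective (Fin.val_injective (f.injective (Subtype.ext hij)))
    · simp only [QuotientGroup.out_eq']
      exact (f (en i)).2
  obtain ⟨g, hginj, hgA⟩ := hg
  let s : ι × Bool → G := fun l => cond l.2 (g l.1) (k l.1)
  let bar : ι × Bool → ι × Bool := fun l => (l.1, !l.2)
  let xx : ι × Bool → G := fun l => cond l.2 (x l.1) (x l.1)⁻¹
  let y : ι × Bool → G := fun l => (s l)⁻¹ * xx l * s (bar l)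
  have hs : ∀ l l', l ≠ l' → ¬ Commute ((s l)⁻¹ * s l') z := by
    rintro ⟨i, b⟩ ⟨i', b'⟩ hne
    apply hCm
    cases b <;> cases b'
    · exact fun h => hne (congrArg (fun t => (t, false)) (hkinj h))
    · exact fun h => hgA i' (Or.inl ⟨i, h⟩)
    · exact fun h => hgA i (Or.inl ⟨i', h.symm⟩)
    · exact fun h => hne (congrArg (fun t => (t, true)) (hginj h))
  have hyt : ∀ i, ¬ Commute (y (i, true)) z := by
    intro i
    have : y (i, true) = (g i)⁻¹ * (x i * k i) := by simp [y, s, xx, bar, mul_assoc]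
    rw [this]
    apply hCm
    exact fun h => hgA i (Or.inr ⟨i, h.symm⟩)
  have hybar : ∀ l, y (bar l) = (y l)⁻¹ := by
    rintro ⟨i, b⟩
    cases b <;> simp [y, s, xx, bar, mul_assoc]
  have hy : ∀ l, ¬ Commute (y l) z := by
    rintro ⟨i, b⟩
    cases b
    · have := hybar (i, true)
      simp only [bar, Bool.not_true] at this
      rw [this, Commute.inv_left_iff]
      exact hyt i
    · exact hyt i
  -- uniform bounds
  have bd : ∀ f : ι × Bool → ℝ, ∃ E : ℝ, ∀ l, f l ≤ E := by
    intro f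
    obtain ⟨E, hE⟩ := (Set.finite_range f).bddAbove
    exact ⟨E, fun l => hE ⟨l, rfl⟩⟩
  have bd2 : ∀ f : (ι × Bool) × (ι × Bool) → ℝ, ∃ E : ℝ, ∀ l, f l ≤ E := by
    intro f
    obtain ⟨E, hE⟩ := (Set.finite_range f).bddAbove
    exact ⟨E, fun l => hE ⟨l, rfl⟩⟩
  obtain ⟨E1, hE1⟩ := bd (fun l => ℓ (s l))
  obtain ⟨E2, hE2⟩ := bd (fun l => ℓ (y l))
  have hT3 : ∀ l, ∃ T : ℝ, ∀ n : ℕ, gp ℓ (z⁻¹ ^ n) (y l * z⁻¹ ^ n) ≤ T := fun l => hm _ (hy l)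
  choose T3 hT3 using hT3
  obtain ⟨E3, hE3⟩ := bd T3
  have hT4 : ∀ l : (ι × Bool) × (ι × Bool), ∃ T : ℝ, l.1 ≠ l.2 → ∀ n : ℕ,
      gp ℓ (z ^ n) ((s l.1)⁻¹ * s l.2 * z ^ n) ≤ T := by
    intro l
    by_cases h : l.1 = l.2
    · exact ⟨0, fun h' => absurd h h'⟩
    · obtain ⟨T, hT⟩ := hp _ (hs _ _ h)
      exact ⟨T, fun _ => hT⟩
  choose T4 hT4 using hT4
  obtain ⟨E4, hE4⟩ := bd2 T4
  obtain ⟨E, hEp, hE1', hE2', hE3', hE4'⟩ : ∃ E : ℝ, 0 ≤ E ∧ E1 ≤ E ∧ E2 ≤ E ∧ E3 ≤ E ∧ E4 ≤ E :=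
    ⟨max 0 (max E1 (max E2 (max E3 E4))), by simp, by simp, by simp, by simp, by simp⟩
  have b1 : ∀ l, ℓ (s l) ≤ E := fun l => (hE1 l).trans hE1'
  have b2 : ∀ l, ℓ (y l) ≤ E := fun l => (hE2 l).trans hE2'
  have b3 : ∀ l n, gp ℓ (z⁻¹ ^ n) (y l * z⁻¹ ^ n) ≤ E :=
    fun l n => ((hT3 l n).trans (hE3 l)).trans hE3'
  have b4 : ∀ l l', l ≠ l' → ∀ n, gp ℓ (z ^ n) ((s l)⁻¹ * s l' * z ^ n) ≤ E :=
    fun l l' h n => ((hT4 (l, l') h n).trans (hE4 (l, l'))).trans hE4'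
  have hxs : ∀ i, x i = s (i, true) * y (i, true) * (s (bar (i, true)))⁻¹ := by
    intro i
    simp [y, xx, mul_assoc]
  clear_value xx y s
  -- choose N
  obtain ⟨N, hN⟩ := exists_nat_gt (ℓ z + 1 + 100 * E + 100 * δ)
  have haN := hz.le L N
  set a := ℓ (z ^ N) with ha
  have hz0 := L.nonneg z
  let W : ι × Bool → G := fun l => s l * z ^ N * y l * (z ^ N)⁻¹ * (s (bar l))⁻¹
  have hbb : ∀ l, bar (bar l) = l := by rintro ⟨i, b⟩; simp [bar]
  have hWinv : ∀ i b, W (i, !b) = (W (i, b))⁻¹ := by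
    intro i b
    have h1 := hybar (i, b)
    have h2 := hbb (i, b)
    change W (bar (i, b)) = _
    simp only [W]
    rw [h1, h2]
    group
  have b5 : ∀ l l', l ≠ l' → gp ℓ (s l * z ^ N) (s l' * z ^ N) ≤ 2 * E := by
    intro l l' h
    have h1 := b4 l l' h N
    unfold gp at h1 ⊢
    have e1 : (z ^ N)⁻¹ * ((s l)⁻¹ * s l' * z ^ N) = (s l * z ^ N)⁻¹ * (s l' * z ^ N) := by group
    rw [e1] at h1
    have h2 := L.mul (s l) (z ^ N)
    have h3 := L.mul (s l) ((s l)⁻¹ * s l' * z ^ N)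
    rw [show s l * ((s l)⁻¹ * s l' * z ^ N) = s l' * z ^ N by group] at h3
    have := b1 l
    linarith
  have b6 : ∀ l, 2 * a - 5 * E ≤ ℓ (W l) := by
    intro l
    have h1 := b3 l N
    unfold gp at h1
    have e1 : ((z⁻¹) ^ N)⁻¹ * (y l * z⁻¹ ^ N) = z ^ N * y l * (z ^ N)⁻¹ := by
      rw [inv_pow]; group
    rw [e1, inv_pow, L.inv] at h1
    have h2 := L.mul (y l)⁻¹ (y l * (z ^ N)⁻¹)
    rw [inv_mul_cancel_left, L.inv, L.inv] at h2
    have h3 := L.mul (s l)⁻¹ (W l)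
    have h4 := L.mul ((s l)⁻¹ * W l) (s (bar l))
    rw [show (s l)⁻¹ * W l * s (bar l) = z ^ N * y l * (z ^ N)⁻¹ by simp only [W]; group] at h4
    rw [L.inv] at h3
    have := b1 l
    have := b1 (bar l)
    have := b2 l
    linarith
  have b7 : ∀ l, a - 4 * E ≤ gp ℓ (W l) (s l * z ^ N) := by
    intro l
    unfold gp
    rw [L.symm, show (s l * z ^ N)⁻¹ * W l = y l * (z ^ N)⁻¹ * (s (bar l))⁻¹ by
      simp only [W]; group]
    have h1 := L.mul (y l * (z ^ N)⁻¹) (s (bar l))⁻¹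
    have h2 := L.mul (y l) (z ^ N)⁻¹
    rw [L.inv] at h1 h2
    have h3 := L.mul (s l)⁻¹ (s l * z ^ N)
    rw [inv_mul_cancel_left, L.inv] at h3
    have := b1 l
    have := b1 (bar l)
    have := b2 l
    have := b6 l
    linarith
  have b8 : ∀ l l', l ≠ l' → gp ℓ (W l) (W l') ≤ 2 * E + 2 * δ := by
    intro l l' h
    by_contra! hc
    have h1 := L.gp_hyp (s l * z ^ N) (W l) (W l')
    have h2 := L.gp_hyp (s l * z ^ N) (W l') (s l' * z ^ N)
    have h3 := b5 l l' h
    have h4 := b7 l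
    have h5 := b7 l'
    rw [L.gp_symm] at h4
    have h6 : 2 * E + 2 * δ < min (gp ℓ (s l * z ^ N) (W l)) (gp ℓ (W l) (W l')) :=
      lt_min (by linarith) hc
    have h7 : 2 * E + δ < min (gp ℓ (s l * z ^ N) (W l')) (gp ℓ (W l') (s l' * z ^ N)) :=
      lt_min (by linarith) (by linarith)
    linarith
  refine ⟨Subgroup.closure (Set.range fun i => W (i, true)), ?_, ?_⟩
  · intro htop
    have hzK : z ∈ Subgroup.closure (Set.range fun i => W (i, true)) := by rw [htop]; trivial
    rw [← FreeGroup.range_lift_eq_closure] at hzK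
    obtain ⟨v, hv⟩ := hzK
    have hred := FreeGroup.isReduced_toWord (x := v)
    rw [← FreeGroup.mk_toWord (x := v), FreeGroup.lift_mk] at hv
    have hmap : (fun l : ι × Bool => cond l.2 (W (l.1, true)) (W (l.1, true))⁻¹) = W := by
      funext ⟨i, b⟩
      cases b
      · exact (hWinv i true).symm
      · rfl
    rw [hmap] at hv
    cases hw : v.toWord with
    | nil =>
      rw [hw] at hv
      simp at hv
      have := hz 0
      rw [← hv] at this
      simp at this
      linarith
    | cons l w =>
      rw [hw] at hv hred
      have := (L.pingpong W hWinv (2 * E + 2 * δ) (ℓ z + 1) (by linarith) b8 (by linarith)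
        (fun l => by have := b6 l; linarith) w l hred).1
      rw [hv] at this
      linarith
  · rw [eq_top_iff, ← hx, Subgroup.closure_le]
    rintro _ ⟨i, rfl⟩
    have e : x i = (s (i, true) * (z ^ N)⁻¹ * (s (i, true))⁻¹) * W (i, true) *
        (s (bar (i, true)) * z ^ N * (s (bar (i, true)))⁻¹) := by
      rw [hxs i]
      simp only [W]
      group
    rw [e]
    have hN : F.Normal := inferInstance
    have hzN := F.pow_mem hzF N
    refine mul_mem (mul_mem (Subgroup.mem_sup_right ?_) (Subgroup.mem_sup_left ?_))
      (Subgroup.mem_sup_right ?_)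
    · exact hN.conj_mem _ (F.inv_mem hzN) _
    · exact Subgroup.subset_closure ⟨i, rfl⟩
    · exact hN.conj_mem _ hzN _

end HypLen

lemma isCoatomic_subgroup_of_fg {G : Type*} [Group G] [hfg : Group.FG G] :
    IsCoatomic (Subgroup G) := by
  refine CompleteLattice.coatomic_of_top_compact ?_
  rw [CompleteLattice.isCompactElement_iff_le_of_directed_sSup_le]
  intro s hs hd hle
  obtain ⟨T, hT⟩ := Group.fg_def.1 hfg
  have hmem : ∀ x ∈ T, ∃ K ∈ s, x ∈ K := by
    intro x _
    exact (Subgroup.mem_sSup_of_directedOn hs hd).1 (hle trivial)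
  have key : ∀ T' : Finset G, (∀ x ∈ T', ∃ K ∈ s, x ∈ K) → ∃ K ∈ s, (T' : Set G) ⊆ K := by
    classical
    intro T'
    induction T' using Finset.induction_on with
    | empty => intro _; obtain ⟨K, hK⟩ := hs; exact ⟨K, hK, by simp⟩
    | insert a t _ ih =>
      intro h
      obtain ⟨K1, hK1, h1⟩ := ih (fun x hx => h x (Finset.mem_insert_of_mem hx))
      obtain ⟨K2, hK2, h2⟩ := h a (Finset.mem_insert_self _ _)
      obtain ⟨K, hK, h3, h4⟩ := hd K1 hK1 K2 hK2
      refine ⟨K, hK, ?_⟩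
      rw [Finset.coe_insert, Set.insert_subset_iff]
      exact ⟨h4 h2, fun x hx => h3 (h1 hx)⟩
  obtain ⟨K, hK, h⟩ := key T hmem
  exact ⟨K, hK, by rw [← hT, Subgroup.closure_le]; exact h⟩

/-- Virtually cyclic case. -/
lemma virtually_cyclic_case {G : Type*} [Group G] (F : Subgroup G) (z : G) (hzF : z ∈ F)
    (hz : ¬ IsOfFinOrder z) (hfin : (Subgroup.zpowers z).index ≠ 0) :
    ∃ K : Subgroup G, K ≠ ⊤ ∧ K ⊔ F = ⊤ := by
  have hfi : (Subgroup.zpowers z).FiniteIndex := ⟨hfin⟩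
  -- pass to the normal core
  set N := (Subgroup.zpowers z).normalCore with hN
  have hNle : N ≤ Subgroup.zpowers z := Subgroup.normalCore_le _
  have hNfi : N.FiniteIndex := inferInstance
  have hNn : N.Normal := inferInstance
  obtain ⟨ζ, hζ⟩ : ∃ ζ, N = Subgroup.zpowers ζ := by
    have hc : IsCyclic (N.subgroupOf (Subgroup.zpowers z)) := inferInstance
    obtain ⟨ζ, hζ⟩ := (Subgroup.isCyclic_iff_exists_zpowers_eq_top _).1 hc
    refine ⟨ζ, ?_⟩
    have := congrArg (Subgroup.map (Subgroup.zpowers z).subtype) hζ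
    rw [MonoidHom.map_zpowers, Subgroup.subgroupOf_map_subtype, inf_of_le_left hNle] at this
    exact this.symm
  have hζF : ζ ∈ F := by
    have : ζ ∈ Subgroup.zpowers z := hNle (hζ ▸ Subgroup.mem_zpowers ζ)
    exact (Subgroup.zpowers_le.2 hzF) this
  have hζo : ¬ IsOfFinOrder ζ := by
    intro h
    apply hz
    have hm : z ^ N.index ∈ N := Subgroup.pow_index_mem N z
    rw [hζ] at hm
    obtain ⟨j, hj⟩ := hm
    have hf : IsOfFinOrder (z ^ (Subgroup.zpowers ζ).index) := by
      rw [← hj]; exact h.zpow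
    rw [← hζ] at hf
    exact (isOfFinOrder_pow.1 hf).resolve_right hNfi.index_ne_zero
  have hinj := injective_zpow_iff_not_isOfFinOrder.2 hζo
  obtain ⟨p, hpge, hp⟩ := Nat.exists_infinite_primes (N.index + 1)
  set P := Subgroup.zpowers (ζ ^ p) with hP
  have hPn : P.Normal := by
    constructor
    rintro _ ⟨j, rfl⟩ g
    have h1 : g * ζ * g⁻¹ ∈ N := hNn.conj_mem _ (hζ ▸ Subgroup.mem_zpowers ζ) g
    rw [hζ] at h1
    obtain ⟨i, hi⟩ := h1
    refine ⟨i * j, ?_⟩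
    simp only at hi ⊢
    rw [← conj_zpow, ← conj_pow, ← hi, ← zpow_natCast, ← zpow_natCast, ← zpow_mul, ← zpow_mul,
      ← zpow_mul]
    congr 1; ring
  let π := QuotientGroup.mk' P
  have hπ : Function.Surjective π := QuotientGroup.mk'_surjective P
  have hker : π.ker ≤ N := by
    rw [QuotientGroup.ker_mk', hζ, hP, Subgroup.zpowers_le]
    exact Subgroup.pow_mem _ (Subgroup.mem_zpowers ζ) p
  have hidx : (N.map π).index = N.index := Subgroup.index_map_eq N hπ hker
  have hcard : Nat.card (N.map π) = p := by
    rw [hζ, MonoidHom.map_zpowers, Nat.card_zpowers]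
    have : Fact p.Prime := ⟨hp⟩
    refine orderOf_eq_prime ?_ ?_
    · rw [← map_pow]
      exact (QuotientGroup.eq_one_iff _).2 (Subgroup.mem_zpowers _)
    · intro h
      have h1 : ζ ∈ P := (QuotientGroup.eq_one_iff _).1 h
      obtain ⟨j, hj⟩ := h1
      simp only at hj
      rw [← zpow_natCast, ← zpow_mul] at hj
      have h2 : (p : ℤ) * j = 1 := hinj (by simpa using hj)
      have h3 : (p : ℤ) ∣ 1 := ⟨j, h2.symm⟩
      have h4 : p ∣ 1 := by exact_mod_cast h3
      exact hp.one_lt.ne' (Nat.dvd_one.1 h4)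
  have hMn : (N.map π).Normal := hNn.map π hπ
  have hcop : Nat.Coprime (Nat.card (N.map π)) (N.map π).index := by
    rw [hcard, hidx, Nat.Prime.coprime_iff_not_dvd hp]
    intro hd
    have := Nat.le_of_dvd (Nat.pos_of_ne_zero hNfi.index_ne_zero) hd
    omega
  obtain ⟨K, hK⟩ := Subgroup.exists_right_complement'_of_coprime hcop
  refine ⟨K.comap π, ?_, ?_⟩
  · intro htop
    have hKt : K = ⊤ := by
      rw [← Subgroup.map_comap_eq_self_of_surjective hπ K, htop, ← MonoidHom.range_eq_map,
        MonoidHom.range_eq_top.2 hπ]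
    have hd := hK.disjoint
    rw [hKt, disjoint_top] at hd
    rw [hd] at hcard
    simp at hcard
    exact hp.one_lt.ne hcard
  · rw [eq_top_iff]
    have hsup := hK.sup_eq_top
    intro g _
    have hg : π g ∈ N.map π ⊔ K := by rw [hsup]; trivial
    obtain ⟨a, ⟨n, hn, rfl⟩, b, hb, hab⟩ := (Subgroup.mem_sup_of_normal_left).1 hg
    have hnF : n ∈ F := by
      have hn' : n ∈ N := hn
      rw [hζ] at hn'
      exact (Subgroup.zpowers_le.2 hζF) hn'
    have : g = n * (n⁻¹ * g) := by group
    rw [this]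
    refine mul_mem (Subgroup.mem_sup_right hnF) (Subgroup.mem_sup_left ?_)
    rw [Subgroup.mem_comap, map_mul, map_inv, ← hab]
    simpa using hb

section word
variable {G : Type*} [Group G] {S : Set G}

lemma wordLength_le (l : List G) (hl : ∀ x ∈ l, x ∈ S ∨ x⁻¹ ∈ S) :
    wordLength S l.prod ≤ l.length := Nat.sInf_le ⟨l, rfl, hl, rfl⟩

lemma wordLength_spec (hS : Subgroup.closure S = ⊤) (g : G) :
    ∃ l : List G, l.length = wordLength S g ∧ (∀ x ∈ l, x ∈ S ∨ x⁻¹ ∈ S) ∧ l.prod = g := by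
  have hne : {n : ℕ | ∃ l : List G, l.length = n ∧ (∀ x ∈ l, x ∈ S ∨ x⁻¹ ∈ S) ∧
      l.prod = g}.Nonempty := by
    have hg : g ∈ Subgroup.closure S := by rw [hS]; trivial
    rw [← Subgroup.mem_toSubmonoid, Subgroup.closure_toSubmonoid] at hg
    obtain ⟨l, hl, hp⟩ := Submonoid.exists_list_of_mem_closure hg
    exact ⟨_, l, rfl, hl, hp⟩
  exact Nat.sInf_mem hne

lemma wordLength_inv_le (hS : Subgroup.closure S = ⊤) (g : G) :
    wordLength S g⁻¹ ≤ wordLength S g := by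
  obtain ⟨l, h1, h2, h3⟩ := wordLength_spec hS g
  rw [← h1, ← h3, List.prod_inv_reverse]
  refine (wordLength_le _ ?_).trans (by simp)
  intro x hx
  simp only [List.mem_reverse, List.mem_map] at hx
  obtain ⟨y, hy, rfl⟩ := hx
  rw [inv_inv]
  exact (h2 y hy).symm

lemma hypLen_of_word (hf : S.Finite) (hS : Subgroup.closure S = ⊤) {δ : ℝ} (hδ : 0 ≤ δ)
    (h4 : GromovFourPoint S δ) : HypLen (fun g => (wordLength S g : ℝ)) δ where
  one := by
    have := wordLength_le (S := S) [] (by simp)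
    simpa using this
  inv g := by
    have h1 := wordLength_inv_le hS g
    have h2 := wordLength_inv_le hS g⁻¹
    rw [inv_inv] at h2
    exact_mod_cast le_antisymm h1 h2
  mul g h := by
    obtain ⟨l, h1, h2, h3⟩ := wordLength_spec hS g
    obtain ⟨l', h1', h2', h3'⟩ := wordLength_spec hS h
    have := wordLength_le (S := S) (l ++ l') (by
      intro x hx
      rcases List.mem_append.1 hx with hx | hx
      · exact h2 x hx
      · exact h2' x hx)
    rw [List.prod_append, h3, h3', List.length_append, h1, h1'] at this
    exact_mod_cast this
  fin R := by
    have hT : {x : G | x ∈ S ∨ x⁻¹ ∈ S}.Finite := hf.union (hf.preimage inv_injective.injOn)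
    have : Finite {x : G | x ∈ S ∨ x⁻¹ ∈ S} := hT
    refine ((List.finite_length_le {x : G | x ∈ S ∨ x⁻¹ ∈ S} ⌊R⌋₊).image
      (fun l => (l.map Subtype.val).prod)).subset ?_
    intro g hg
    obtain ⟨l, h1, h2, h3⟩ := wordLength_spec hS g
    refine ⟨l.attach.map (fun x => ⟨x.1, h2 x.1 x.2⟩), ?_, ?_⟩
    · simp only [Set.mem_ofPred_eq, List.length_map, List.length_attach, h1]
      exact Nat.le_floor hg
    · simp [h3, List.map_map, Function.comp_def]
  dpos := hδ
  hyp := h4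

lemma word_mid (hS : Subgroup.closure S = ⊤) (g : G) :
    ∃ p : G, (wordLength S p : ℝ) ≤ wordLength S g / 2 + 1 / 2 ∧
      (wordLength S (p⁻¹ * g) : ℝ) ≤ wordLength S g / 2 + 1 / 2 := by
  obtain ⟨l, h1, h2, h3⟩ := wordLength_spec hS g
  have a := wordLength_le (S := S) (l.take (l.length / 2)) (fun x hx => h2 x (List.mem_of_mem_take hx))
  have b := wordLength_le (S := S) (l.drop (l.length / 2)) (fun x hx => h2 x (List.mem_of_mem_drop hx))
  rw [List.length_take] at a
  rw [List.length_drop] at b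
  have e : (l.take (l.length / 2)).prod⁻¹ * g = (l.drop (l.length / 2)).prod := by
    rw [← h3]
    conv_lhs => rw [← List.prod_take_mul_prod_drop l (l.length / 2)]
    group
  refine ⟨(l.take (l.length / 2)).prod, ?_, ?_⟩
  · have : 2 * wordLength S (l.take (l.length / 2)).prod ≤ wordLength S g + 1 := by omega
    have : (2 : ℝ) * wordLength S (l.take (l.length / 2)).prod ≤ wordLength S g + 1 := by
      exact_mod_cast this
    linarith
  · rw [e]
    have : 2 * wordLength S (l.drop (l.length / 2)).prod ≤ wordLength S g + 1 := by omega
    have : (2 : ℝ) * wordLength S (l.drop (l.length / 2)).prod ≤ wordLength S g + 1 := by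
      exact_mod_cast this
    linarith

end word

/-- Every element of the Frattini subgroup of a finitely generated subgroup `H`
of a word-hyperbolic group `G` has finite order. -/
theorem frattini_torsion_of_fg_subgroup_of_hyperbolic {G : Type*} [Group G]
    (hG : IsWordHyperbolic G) (H : Subgroup G) (hH : H.FG) :
    ∀ h : H, h ∈ frattini H → IsOfFinOrder h := by
  intro h hF
  by_contra hh
  obtain ⟨S, hS, δ, hδ, h4⟩ := hG
  have LG := hypLen_of_word S.finite_toSet hS hδ h4
  have hhG : ¬ IsOfFinOrder (h : G) := by rwa [Submonoid.isOfFinOrder_coe]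
  obtain ⟨k, hk, hgood⟩ := LG.exists_good (word_mid hS) (h : G) hhG
  -- restrict to `H`
  set ℓ : H → ℝ := fun g => (wordLength (S : Set G) (g : G) : ℝ) with hℓ
  have L : HypLen ℓ δ :=
    { one := LG.one
      inv := fun g => LG.inv g
      mul := fun g g' => LG.mul g g'
      fin := fun R => (LG.fin R).preimage Subtype.val_injective.injOn
      dpos := hδ
      hyp := fun x y z w => LG.hyp x y z w }
  set z0 : H := h ^ k with hz0
  have hz0g : HypLen.Good ℓ δ z0 := hgood
  set e := HypLen.expo ℓ δ z0 with he
  have he1 : 1 ≤ e := Nat.factorial_pos _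
  set z := z0 ^ e with hz
  have hzg : HypLen.Good ℓ δ z := hz0g.pow L he1
  have hzF : z ∈ frattini H := pow_mem (pow_mem hF k) e
  have hzo : ¬ IsOfFinOrder z := by
    intro hc
    rcases isOfFinOrder_pow.1 hc with hc | hc
    · rcases isOfFinOrder_pow.1 hc with hc | hc
      · exact hh hc
      · omega
    · omega
  have hfg : Group.FG H := (Group.fg_iff_subgroup_fg H).2 hH
  have hco : IsCoatomic (Subgroup H) := isCoatomic_subgroup_of_fg
  have key : ∃ K : Subgroup H, K ≠ ⊤ ∧ K ⊔ frattini H = ⊤ := by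
    by_cases hfin : Finite (H ⧸ Subgroup.centralizer {z})
    · refine virtually_cyclic_case _ z hzF hzo ?_
      -- `⟨z⟩` has finite index in its centralizer
      have hle : Subgroup.zpowers z ≤ Subgroup.centralizer {z} := by
        rw [Subgroup.zpowers_le, Subgroup.mem_centralizer_singleton_iff]
      have hall : Finite (H ⧸ Subgroup.zpowers z) := by
        classical
        have hB := L.fin (2 * ℓ z + 6 * δ)
        have hBf : Finite {g | ℓ g ≤ 2 * ℓ z + 6 * δ} := hB
        let f : (H ⧸ Subgroup.centralizer {z}) × {g | ℓ g ≤ 2 * ℓ z + 6 * δ} →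
          H ⧸ Subgroup.zpowers z := fun q => ((q.1.out * q.2.1 : H) : H ⧸ Subgroup.zpowers z)
        refine Finite.of_surjective f ?_
        intro q
        obtain ⟨g, rfl⟩ := QuotientGroup.mk_surjective q
        set o := (g : H ⧸ Subgroup.centralizer {z}).out
        have ho : o⁻¹ * g ∈ Subgroup.centralizer {z} := by
          rw [← QuotientGroup.eq, QuotientGroup.out_eq']
        rw [Subgroup.mem_centralizer_singleton_iff] at ho
        obtain ⟨j, hj⟩ := hzg.near L (o⁻¹ * g) ho
        refine ⟨((g : H ⧸ Subgroup.centralizer {z}), ⟨_, hj⟩), ?_⟩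
        change ((o * (o⁻¹ * g * z ^ j) : H) : H ⧸ Subgroup.zpowers z) = g
        rw [QuotientGroup.eq]
        refine ⟨-j, ?_⟩
        simp only
        group
      exact (Subgroup.finiteIndex_of_finite_quotient).index_ne_zero
    · obtain ⟨T, hT⟩ := Group.fg_def.1 hfg
      refine L.nonelementary (frattini H) hzF hzg ?_ ?_ (not_finite_iff_infinite.1 hfin)
        (ι := T) (fun t => (t : H)) (by simpa using hT)
      · intro u hu
        by_contra! hc
        apply hu
        refine hz0g.commute L u (fun R => ?_)
        obtain ⟨n, hn⟩ := hc R
        refine ⟨e * n, e * n, ?_⟩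
        rw [pow_mul]
        exact hn.le
      · intro u hu
        by_contra! hc
        apply hu
        have := (hz0g.inv L).commute L u (fun R => ?_)
        · rw [HypLen.expo_inv L, inv_pow, Commute.inv_right_iff] at this
          exact this
        · obtain ⟨n, hn⟩ := hc R
          refine ⟨e * n, e * n, ?_⟩
          rw [pow_mul, inv_pow z0 e]
          exact hn.le
  obtain ⟨K, hK, hKF⟩ := key
  exact hK (frattini_nongenerating hKF)
end
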